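/- arXiv:1603.08687 — 9 statements merged into one kernel-verified Lean document; each statement's English description precedes it below -/
import Mathlib

section
/- Let (X,d) be a generalized metric space and let A, B : X → X be self-mappings with A(X) ⊆ B(X) such that (B(X), d) is a complete generalized metric space. Suppose there exist a constant C ≥ 0 and a function φ : [0,∞) → [0,∞) that is continuous, nondecreasing, satisfies φ(t) = 0 ⟺ t = 0 and φ(t) < t for all t > 0, such that for all x, y ∈ X: d(Ax,Ay) ≤ φ(M(x,y)) + C·min{d(Bx,Ax), d(By,Ay), d(Bx,Ay), d(By,Ax)}, where M(x,y) = max{d(Bx,By), d(Bx,Ax)(d(By,Ay)+1)/(1+d(Bx,By)), d(By,Ay)(d(Bx,Ax)+1)/(1+d(Bx,By))}. Then A and B have a unique point of coincidence in X. Moreover, if A and B are weakly compatible, then A and B have a unique common fixed point. -/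
open Filter Topology

/-- A generalized metric in the sense of Branciari: the triangle inequality is replaced by the
quadrilateral inequality for pairwise distinct points. -/
structure IsBranciariMetric {Y : Type*} (d : Y → Y → ℝ) : Prop where
  nonneg : ∀ x y, 0 ≤ d x y
  eq_zero_iff : ∀ x y, d x y = 0 ↔ x = y
  symm : ∀ x y, d x y = d y x
  quad : ∀ w x y z : Y, w ≠ x → w ≠ y → w ≠ z → x ≠ y → x ≠ z → y ≠ z →
    d w x ≤ d w y + d y z + d z x

/-- A continuous nondecreasing comparison function on `[0, ∞)`. -/
structure IsComparison (φ : ℝ → ℝ) : Prop where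
  continuousOn : ContinuousOn φ (Set.Ici 0)
  monotoneOn : MonotoneOn φ (Set.Ici 0)
  map_zero : φ 0 = 0
  map_lt : ∀ t, 0 < t → φ t < t

/-- The rational expression controlling the contraction, in terms of `a = d x y`, `p = d x (T x)`
and `q = d y (T y)`. -/
noncomputable def rationalMax (a p q : ℝ) : ℝ :=
  max a (max (p * (q + 1) / (1 + a)) (q * (p + 1) / (1 + a)))

lemma rationalMax_nonneg {a : ℝ} (ha : 0 ≤ a) (p q : ℝ) : 0 ≤ rationalMax a p q :=
  ha.trans (le_max_left _ _)

lemma rationalMax_le {a p q s : ℝ} (ha : 0 ≤ a) (hp : 0 ≤ p) (hq : 0 ≤ q)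
    (h₁ : p * (q + 1) ≤ s) (h₂ : q * (p + 1) ≤ s) : rationalMax a p q ≤ max a s := by
  have h1a : (1 : ℝ) ≤ 1 + a := by linarith
  refine max_le_max le_rfl (max_le ?_ ?_)
  · exact (div_le_self (by positivity) h1a).trans h₁
  · exact (div_le_self (by positivity) h1a).trans h₂

lemma rationalMax_self_le {p q : ℝ} (hp : 0 ≤ p) :
    rationalMax p p q ≤ max p q := by
  have h1p : (0 : ℝ) < 1 + p := by linarith
  refine max_le (le_max_left _ _) (max_le ?_ ?_)
  · rw [div_le_iff₀ h1p]
    rcases le_total p q with h | h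
    · rw [max_eq_right h]; nlinarith
    · rw [max_eq_left h]; nlinarith
  · rw [div_le_iff₀ h1p]
    nlinarith [le_max_right p q]

namespace IsComparison

variable {φ : ℝ → ℝ}

lemma le_self (hφ : IsComparison φ) {t : ℝ} (ht : 0 ≤ t) : φ t ≤ t := by
  rcases ht.eq_or_lt with rfl | h
  · exact hφ.map_zero.le
  · exact (hφ.map_lt t h).le

lemma eq_zero_of_le (hφ : IsComparison φ) {t : ℝ} (ht : 0 ≤ t) (h : t ≤ φ t) : t = 0 := by
  by_contra h0
  exact (hφ.map_lt t (lt_of_le_of_ne ht (Ne.symm h0))).not_ge h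

lemma tendsto (hφ : IsComparison φ) {u : ℕ → ℝ} {l : ℝ} (hu : ∀ n, 0 ≤ u n)
    (hl : Tendsto u atTop (𝓝 l)) : Tendsto (fun n => φ (u n)) atTop (𝓝 (φ l)) := by
  have hl0 : 0 ≤ l := ge_of_tendsto' hl hu
  exact (hφ.continuousOn l hl0).tendsto.comp
    (tendsto_nhdsWithin_iff.2 ⟨hl, Eventually.of_forall hu⟩)

lemma tendsto_zero_of_le (hφ : IsComparison φ) {u : ℕ → ℝ} (hu : ∀ n, 0 ≤ u n)
    (h : ∀ n, u (n + 1) ≤ φ (u n)) : Tendsto u atTop (𝓝 0) := by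
  have hanti : Antitone u :=
    antitone_nat_of_succ_le fun n => (h n).trans (hφ.le_self (hu n))
  have hlim := tendsto_atTop_ciInf hanti ⟨0, by rintro _ ⟨n, rfl⟩; exact hu n⟩
  have h0 := hφ.eq_zero_of_le (ge_of_tendsto' hlim hu)
    (le_of_tendsto_of_tendsto' (hlim.comp (tendsto_add_atTop_nat 1)) (hφ.tendsto hu hlim) h)
  rwa [h0] at hlim

end IsComparison

/-- The rational-type contraction condition for a single self-map. -/
def IsRationalContraction {Y : Type*} (d : Y → Y → ℝ) (φ : ℝ → ℝ) (C : ℝ) (T : Y → Y) : Prop :=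
  ∀ x y, d (T x) (T y) ≤ φ (rationalMax (d x y) (d x (T x)) (d y (T y))) +
    C * min (min (d x (T x)) (d y (T y))) (min (d x (T y)) (d y (T x)))

namespace IsRationalContraction

variable {Y : Type*} {d : Y → Y → ℝ} {φ : ℝ → ℝ} {C : ℝ} {T : Y → Y}

lemma dist_succ_le (hd : IsBranciariMetric d) (hφ : IsComparison φ)
    (hT : IsRationalContraction d φ C T) (x : Y) :
    d (T x) (T (T x)) ≤ φ (d x (T x)) := by
  have hp := hd.nonneg x (T x)
  have hq := hd.nonneg (T x) (T (T x))
  have hmin : min (min (d x (T x)) (d (T x) (T (T x))))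
      (min (d x (T (T x))) (d (T x) (T x))) = 0 := by
    rw [(hd.eq_zero_iff (T x) (T x)).2 rfl, min_eq_right (hd.nonneg _ _),
      min_eq_right (le_min hp hq)]
  have h := hT x (T x)
  rw [hmin, mul_zero, add_zero] at h
  have h' := h.trans (hφ.monotoneOn (rationalMax_nonneg hp _ _) (le_max_of_le_left hp)
    (rationalMax_self_le hp))
  rcases le_total (d x (T x)) (d (T x) (T (T x))) with hle | hle
  · rw [max_eq_right hle] at h'
    have h0 := hφ.eq_zero_of_le hq h'
    have h0' : d x (T x) = 0 := le_antisymm (h0 ▸ hle) hp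
    rw [h0, h0', hφ.map_zero]
  · rwa [max_eq_left hle] at h'

lemma dist_map_le (hd : IsBranciariMetric d) (hφ : IsComparison φ) (hC : 0 ≤ C)
    (hT : IsRationalContraction d φ C T) {x y : Y} (hxy : d y (T y) ≤ d x (T x)) :
    d (T x) (T y) ≤ φ (max (d x y) (d x (T x) * (d x (T x) + 1))) + C * d x (T x) := by
  have hp := hd.nonneg x (T x)
  have hq := hd.nonneg y (T y)
  have ha := hd.nonneg x y
  refine (hT x y).trans (add_le_add ?_ ?_)
  · refine hφ.monotoneOn (rationalMax_nonneg ha _ _) (le_max_of_le_left ha)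
      (rationalMax_le ha hp hq ?_ ?_)
    · gcongr
    · gcongr
  · gcongr
    exact (min_le_left _ _).trans (min_le_left _ _)

/-- An injective orbit of a rational contraction is Cauchy. -/
lemma orbit_cauchy (hd : IsBranciariMetric d) (hφ : IsComparison φ) (hC : 0 ≤ C)
    (hT : IsRationalContraction d φ C T) {y : ℕ → Y} (hy : ∀ n, y (n + 1) = T (y n))
    (hinj : Function.Injective y) {ε : ℝ} (hε : 0 < ε) :
    ∃ K, ∀ m n, K ≤ m → K ≤ n → d (y m) (y n) < ε := by
  have hs : ∀ n, d (y (n + 1)) (y (n + 2)) ≤ φ (d (y n) (y (n + 1))) := fun n => by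
    simpa only [hy] using hT.dist_succ_le hd hφ (y n)
  have h0 : Tendsto (fun n => d (y n) (y (n + 1))) atTop (𝓝 0) :=
    hφ.tendsto_zero_of_le (fun n => hd.nonneg _ _) hs
  have hanti : Antitone fun n => d (y n) (y (n + 1)) :=
    antitone_nat_of_succ_le fun n => (hs n).trans (hφ.le_self (hd.nonneg _ _))
  have hstep : ∀ {n m : ℕ}, n ≤ m → d (y (n + 1)) (y (m + 1)) ≤
      φ (max (d (y n) (y m)) (d (y n) (y (n + 1)) * (d (y n) (y (n + 1)) + 1))) +
        C * d (y n) (y (n + 1)) := fun {n m} hnm => by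
    have h := hanti hnm
    simp only [hy] at h ⊢
    exact hT.dist_map_le hd hφ hC h
  have hquad : ∀ {a b c e : ℕ}, a ≠ b → a ≠ c → a ≠ e → b ≠ c → b ≠ e → c ≠ e →
      d (y a) (y b) ≤ d (y a) (y c) + d (y c) (y e) + d (y e) (y b) :=
    fun h₁ h₂ h₃ h₄ h₅ h₆ => hd.quad _ _ _ _ (hinj.ne h₁) (hinj.ne h₂) (hinj.ne h₃)
      (hinj.ne h₄) (hinj.ne h₅) (hinj.ne h₆)
  have hδ : Tendsto (fun n => d (y n) (y (n + 1)) * (d (y n) (y (n + 1)) + 1)) atTop (𝓝 0) := by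
    simpa using h0.mul (h0.add_const 1)
  have hodd : ∀ η > (0 : ℝ), ∃ K, ∀ n ≥ K, ∀ k, d (y n) (y (n + 2 * k + 1)) ≤ η := by
    intro η hη
    have hgap : 0 < η - φ η := sub_pos.2 (hφ.map_lt η hη)
    have h2C : Tendsto (fun n => (2 + C) * d (y n) (y (n + 1))) atTop (𝓝 0) := by
      simpa using h0.const_mul (2 + C)
    obtain ⟨K, hK⟩ := eventually_atTop.1
      ((h0.eventually_le_const hη).and ((hδ.eventually_le_const hη).and
        (h2C.eventually_le_const hgap)))
    refine ⟨K, fun n hn k => ?_⟩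
    obtain ⟨hK₁, hK₂, hK₃⟩ := hK n hn
    induction k with
    | zero => simpa using hK₁
    | succ k ih =>
      have hq := hquad (a := n) (b := n + 2 * (k + 1) + 1) (c := n + 1) (e := n + 2 * k + 1 + 1)
        (by omega) (by omega) (by omega) (by omega) (by omega) (by omega)
      have hmid := hstep (n := n) (m := n + 2 * k + 1) (by omega)
      have hmono := hφ.monotoneOn (le_max_of_le_left (hd.nonneg _ _)) hη.le (max_le ih hK₂)
      have hlast : d (y (n + 2 * k + 1 + 1)) (y (n + 2 * (k + 1) + 1)) ≤ d (y n) (y (n + 1)) :=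
        hanti (show n ≤ n + 2 * k + 1 + 1 by omega)
      linarith
  have hodd' : ∀ η > (0 : ℝ), ∃ K, ∀ m ≥ K, ∀ n ≥ K, Odd (m + n) → d (y m) (y n) ≤ η := by
    intro η hη
    obtain ⟨K, hK⟩ := hodd η hη
    refine ⟨K, fun m hm n hn ⟨k, hk⟩ => ?_⟩
    rcases le_total m n with h | h
    · have := hK m hm (k - m)
      rwa [show m + 2 * (k - m) + 1 = n by omega] at this
    · have := hK n hn (k - n)
      rw [hd.symm]
      rwa [show n + 2 * (k - n) + 1 = m by omega] at this
  have heven : ∀ η > (0 : ℝ), ∃ K, ∀ m ≥ K, ∀ n ≥ K, ∀ p ≥ K, m ≠ n → Even (m + n) →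
      Odd (m + p) → d (y m) (y n) ≤ 2 * η + d (y p) (y (p + 2)) := by
    intro η hη
    obtain ⟨K, hK⟩ := hodd' η hη
    refine ⟨K, fun m hm n hn p hp hne ⟨i, hi⟩ ⟨j, hj⟩ => ?_⟩
    have hq := hquad (a := m) (b := n) (c := p) (e := p + 2)
      (by omega) (by omega) (by omega) (by omega) (by omega) (by omega)
    have h₁ := hK m hm p hp ⟨j, hj⟩
    have h₂ := hK (p + 2) (by omega) n hn (by rw [Nat.odd_iff]; omega)
    linarith
  have hclose : ∀ η > (0 : ℝ), ∃ K, ∀ m ≥ K, ∀ n ≥ K,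
      d (y m) (y (m + 2)) ≤ 4 * η + d (y n) (y (n + 2)) := by
    intro η hη
    obtain ⟨K, hK⟩ := heven η hη
    refine ⟨K, fun m hm n hn => ?_⟩
    rcases Nat.even_or_odd (m + n) with h | h
    · have h₁ := hK m hm (m + 2) (by omega) (n + 1) (by omega) (by omega)
        ⟨m + 1, by omega⟩ (by rw [← add_assoc]; exact h.add_one)
      have h₂ := hK (n + 1) (by omega) (n + 1 + 2) (by omega) n hn (by omega)
        ⟨n + 2, by omega⟩ ⟨n, by omega⟩
      linarith
    · have := hK m hm (m + 2) (by omega) n hn (by omega) ⟨m + 1, by omega⟩ h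
      linarith
  have hcau : CauchySeq fun n => d (y n) (y (n + 2)) := by
    refine Metric.cauchySeq_iff.2 fun η hη => ?_
    obtain ⟨K, hK⟩ := hclose (η / 5) (by positivity)
    refine ⟨K, fun m hm n hn => ?_⟩
    rw [Real.dist_eq, abs_sub_lt_iff]
    constructor <;> linarith [hK m hm n hn, hK n hn m hm]
  obtain ⟨l, hl⟩ := cauchySeq_tendsto_of_complete hcau
  have hl0 : 0 ≤ l := ge_of_tendsto' hl fun n => hd.nonneg _ _
  have hlφ : l ≤ φ l := by
    have hmax := hl.max hδ
    rw [max_eq_left hl0] at hmax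
    have hrhs := (hφ.tendsto (fun n => le_max_of_le_left (hd.nonneg _ _)) hmax).add
      (h0.const_mul C)
    rw [mul_zero, add_zero] at hrhs
    exact le_of_tendsto_of_tendsto' (hl.comp (tendsto_add_atTop_nat 1)) hrhs
      fun n => hstep (n := n) (m := n + 2) (by omega)
  rw [hφ.eq_zero_of_le hl0 hlφ] at hl
  obtain ⟨K₁, hK₁⟩ := hodd' (ε / 2) (by positivity)
  obtain ⟨K₂, hK₂⟩ := heven (ε / 4) (by positivity)
  obtain ⟨K₃, hK₃⟩ := eventually_atTop.1 (hl.eventually_lt_const (half_pos hε))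
  refine ⟨max K₁ (max K₂ K₃), fun m n hm hn => ?_⟩
  simp only [max_le_iff] at hm hn
  rcases eq_or_ne m n with rfl | hne
  · rwa [(hd.eq_zero_iff _ _).2 rfl]
  rcases Nat.even_or_odd (m + n) with h | h
  · have h₁ := hK₂ m hm.2.1 n hn.2.1 (m + 1) (by omega) hne h ⟨m, by omega⟩
    have h₂ := hK₃ (m + 1) (by omega)
    linarith
  · linarith [hK₁ m hm.1 n hn.1 h]

/-- A limit of an injective orbit of a rational contraction is a fixed point. -/
lemma map_eq_of_orbit_tendsto (hd : IsBranciariMetric d) (hφ : IsComparison φ) (hC : 0 ≤ C)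
    (hT : IsRationalContraction d φ C T) {y : ℕ → Y} (hy : ∀ n, y (n + 1) = T (y n))
    (hinj : Function.Injective y) {z : Y} (hz : Tendsto (fun n => d (y n) z) atTop (𝓝 0)) :
    T z = z := by
  by_contra hne
  have h0 : Tendsto (fun n => d (y n) (y (n + 1))) atTop (𝓝 0) :=
    hφ.tendsto_zero_of_le (fun n => hd.nonneg _ _) fun n => by
      simpa only [hy] using hT.dist_succ_le hd hφ (y n)
  have hM : Tendsto (fun n => rationalMax (d (y n) z) (d (y n) (y (n + 1))) (d z (T z))) atTop
      (𝓝 (d z (T z))) := by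
    have hden : Tendsto (fun n => 1 + d (y n) z) atTop (𝓝 1) := by simpa using hz.const_add 1
    have h₁ := (h0.mul_const (d z (T z) + 1)).div hden one_ne_zero
    have h₂ := ((h0.add_const 1).const_mul (d z (T z))).div hden one_ne_zero
    have h := hz.max (h₁.max h₂)
    have hlim : max 0 (max (0 * (d z (T z) + 1) / 1) (d z (T z) * (0 + 1) / 1)) = d z (T z) := by
      simp [hd.nonneg]
    rw [hlim] at h
    exact h
  have hrhs := (hz.add h0).add
    ((hφ.tendsto (fun n => rationalMax_nonneg (hd.nonneg _ _) _ _) hM).add (h0.const_mul C))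
  simp only [mul_zero, add_zero, zero_add] at hrhs
  have hev : ∀ w, ∀ᶠ n in atTop, y n ≠ w := fun w => by
    have h := (hinj.tendsto_cofinite).eventually (Set.finite_singleton w).compl_mem_cofinite
    rw [Nat.cofinite_eq_atTop] at h
    exact h
  have hle : ∀ᶠ n in atTop, d z (T z) ≤ d (y n) z + d (y n) (y (n + 1)) +
      (φ (rationalMax (d (y n) z) (d (y n) (y (n + 1))) (d z (T z))) +
        C * d (y n) (y (n + 1))) := by
    filter_upwards [hev z, hev (T z), (tendsto_add_atTop_nat 1).eventually (hev z),
      (tendsto_add_atTop_nat 1).eventually (hev (T z))] with n h₁ h₂ h₃ h₄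
    have hq := hd.quad z (T z) (y n) (y (n + 1)) (Ne.symm hne) h₁.symm h₃.symm h₂.symm h₄.symm
      (hinj.ne (by omega))
    have hc := hT (y n) z
    rw [← hy] at hc
    have hmin : C * min (min (d (y n) (y (n + 1))) (d z (T z)))
        (min (d (y n) (T z)) (d z (y (n + 1)))) ≤ C * d (y n) (y (n + 1)) := by
      gcongr
      exact (min_le_left _ _).trans (min_le_left _ _)
    rw [hd.symm z (y n)] at hq
    linarith
  have hzero := hφ.eq_zero_of_le (hd.nonneg z (T z)) (ge_of_tendsto hrhs hle)
  exact hne ((hd.eq_zero_iff _ _).1 hzero).symm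

theorem exists_fixedPoint [Nonempty Y] (hd : IsBranciariMetric d) (hφ : IsComparison φ)
    (hC : 0 ≤ C) (hT : IsRationalContraction d φ C T)
    (hcomplete : ∀ s : ℕ → Y,
      (∀ ε > (0 : ℝ), ∃ K : ℕ, ∀ m n, K ≤ m → K ≤ n → d (s m) (s n) < ε) →
      ∃ x, Tendsto (fun n => d (s n) x) atTop (𝓝 0)) :
    ∃ z, T z = z := by
  by_contra! hfix
  obtain ⟨y₀⟩ := ‹Nonempty Y›
  have hy : ∀ n, T^[n + 1] y₀ = T (T^[n] y₀) := fun n => Function.iterate_succ_apply' T n y₀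
  have hanti : StrictAnti fun n => d (T^[n] y₀) (T^[n + 1] y₀) := by
    refine strictAnti_nat_of_succ_lt fun n => ?_
    simp only [hy]
    refine (hT.dist_succ_le hd hφ _).trans_lt (hφ.map_lt _ ?_)
    exact lt_of_le_of_ne (hd.nonneg _ _)
      fun h => hfix _ ((hd.eq_zero_iff _ _).1 h.symm).symm
  have hinj : Function.Injective fun n => T^[n] y₀ := fun m n h => hanti.injective <| by
    simp only [hy] at h ⊢
    rw [h]
  obtain ⟨z, hz⟩ := hcomplete _ fun ε hε => hT.orbit_cauchy hd hφ hC hy hinj hε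
  exact hfix z (hT.map_eq_of_orbit_tendsto hd hφ hC hy hinj hz)

end IsRationalContraction


/-- **Theorem 3.1.** Two self-maps `A`, `B` of a generalized metric space (in the sense of
Branciari) with `A(X) ⊆ B(X)`, `(B(X), d)` complete, satisfying the rational-type contraction,
have a unique point of coincidence; if moreover they are weakly compatible, they have a unique
common fixed point. -/
theorem coincidence_point_rational_contraction
    {X : Type*} [Nonempty X] (d : X → X → ℝ)
    (hd_nonneg : ∀ x y, 0 ≤ d x y)
    (hd_eq : ∀ x y, d x y = 0 ↔ x = y)
    (hd_symm : ∀ x y, d x y = d y x)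
    (hd_quad : ∀ w x y z : X, w ≠ x → w ≠ y → w ≠ z → x ≠ y → x ≠ z → y ≠ z →
      d w x ≤ d w y + d y z + d z x)
    (A B : X → X)
    (hAB : Set.range A ⊆ Set.range B)
    (hcomplete : ∀ s : ℕ → X, (∀ n, s n ∈ Set.range B) →
      (∀ ε > (0 : ℝ), ∃ K : ℕ, ∀ r s', K ≤ s' → s' < r → d (s r) (s s') < ε) →
      ∃ x ∈ Set.range B, Filter.Tendsto (fun n => d (s n) x) Filter.atTop (nhds 0))
    (C : ℝ) (hC : 0 ≤ C)
    (φ : ℝ → ℝ)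
    (hφ_nonneg : ∀ t, 0 ≤ t → 0 ≤ φ t)
    (hφ_cont : ContinuousOn φ (Set.Ici 0))
    (hφ_mono : MonotoneOn φ (Set.Ici 0))
    (hφ_zero : ∀ t, 0 ≤ t → (φ t = 0 ↔ t = 0))
    (hφ_lt : ∀ t, 0 < t → φ t < t)
    (hcontr : ∀ x y : X,
      d (A x) (A y) ≤
        φ (max (d (B x) (B y))
            (max (d (B x) (A x) * (d (B y) (A y) + 1) / (1 + d (B x) (B y)))
                 (d (B y) (A y) * (d (B x) (A x) + 1) / (1 + d (B x) (B y)))))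
        + C * min (min (d (B x) (A x)) (d (B y) (A y)))
                  (min (d (B x) (A y)) (d (B y) (A x)))) :
    (∃! z : X, ∃ u : X, z = A u ∧ z = B u) ∧
    ((∀ u : X, A u = B u → A (B u) = B (A u)) →
      ∃! z : X, A z = z ∧ B z = z) := by
  have hd : IsBranciariMetric d := ⟨hd_nonneg, hd_eq, hd_symm, hd_quad⟩
  have hφ : IsComparison φ :=
    ⟨hφ_cont, hφ_mono, (hφ_zero 0 le_rfl).2 rfl, hφ_lt⟩
  have hex : ∃ u, A u = B u := by
    have hdS : IsBranciariMetric fun x y : Set.range B => d x y :=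
      ⟨fun _ _ => hd_nonneg _ _, fun _ _ => (hd_eq _ _).trans Subtype.ext_iff.symm,
        fun _ _ => hd_symm _ _, fun w x y z h₁ h₂ h₃ h₄ h₅ h₆ => hd_quad w x y z
          (Subtype.coe_injective.ne h₁) (Subtype.coe_injective.ne h₂)
          (Subtype.coe_injective.ne h₃) (Subtype.coe_injective.ne h₄)
          (Subtype.coe_injective.ne h₅) (Subtype.coe_injective.ne h₆)⟩
    choose g hg using fun z : Set.range B => z.2
    let T : Set.range B → Set.range B := fun z => ⟨A (g z), hAB ⟨g z, rfl⟩⟩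
    have hT : IsRationalContraction (fun x y : Set.range B => d x y) φ C T := fun x y => by
      have h := hcontr (g x) (g y)
      rw [hg, hg] at h
      exact h
    obtain ⟨z, hz⟩ := hT.exists_fixedPoint hdS hφ hC fun s hs => by
      obtain ⟨x, hx, hlim⟩ := hcomplete (fun n => s n) (fun n => (s n).2) fun ε hε => by
        obtain ⟨K, hK⟩ := hs ε hε
        exact ⟨K, fun m n hn hnm => hK m n (hn.trans hnm.le) hn⟩
      exact ⟨⟨x, hx⟩, hlim⟩
    exact ⟨g z, (congrArg Subtype.val hz).trans (hg z).symm⟩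
  have huniq : ∀ u v, A u = B u → A v = B v → A u = A v := by
    intro u v hu hv
    have h := hcontr u v
    have hself : ∀ x, d x x = 0 := fun x => (hd_eq x x).2 rfl
    rw [← hu, ← hv, hself, hself] at h
    have hmin : min (d (A u) (A v)) (d (A v) (A u)) ≥ 0 :=
      le_min (hd_nonneg _ _) (hd_nonneg _ _)
    simp only [zero_mul, zero_div, max_self, min_self, min_eq_left hmin, mul_zero, add_zero,
      max_eq_left (hd_nonneg (A u) (A v))] at h
    exact (hd_eq _ _).1 (hφ.eq_zero_of_le (hd_nonneg _ _) h)
  obtain ⟨u, hu⟩ := hex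
  refine ⟨⟨A u, ⟨u, rfl, hu⟩, ?_⟩, fun hweak => ⟨A u, ?_, ?_⟩⟩
  · rintro _ ⟨v, rfl, hv⟩
    exact huniq v u hv hu
  · have hc : A (A u) = B (A u) := by
      rw [← hweak u hu, hu]
    have hfix : A (A u) = A u := huniq _ _ hc hu
    exact ⟨hfix, hc.symm.trans hfix⟩
  · rintro w ⟨hAw, hBw⟩
    exact hAw.symm.trans (huniq w u (hAw.trans hBw.symm) hu)
end

section
/- Let (X,d) be a generalized metric space, let A, B : X → X satisfy A(X) ⊆ B(X), and suppose there exist C ≥ 0 and φ : [0,∞) → [0,∞) continuous, nondecreasing, with φ(t) = 0 ⟺ t = 0 and φ(t) < t for t > 0, such that d(Ax,Ay) ≤ φ(M(x,y)) + C·min{d(Bx,Ax), d(By,Ay), d(Bx,Ay), d(By,Ax)} for all x, y ∈ X, where M(x,y) = max{d(Bx,By), d(Bx,Ax)(d(By,Ay)+1)/(1+d(Bx,By)), d(By,Ay)(d(Bx,Ax)+1)/(1+d(Bx,By))}. Let (xₙ) be a sequence in X with B x_{n+1} = A xₙ for all n, set zₙ = A xₙ, and assume zₙ ≠ z_{n+1}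 for all n. Then the sequence (d(zₙ, z_{n+1})) is strictly decreasing and converges to 0. -/
/-- A bound by a comparison function of the rational maximum collapses to a bound by its value
at the preceding term. -/
theorem lt_and_le_of_le_rational_max {φ : ℝ → ℝ} (hφ_lt : ∀ t, 0 < t → φ t < t)
    {a b : ℝ} (ha : 0 < a) (hb : 0 < b)
    (h : b ≤ φ (max a (max (a * (b + 1) / (1 + a)) (b * (a + 1) / (1 + a))))) :
    b < a ∧ b ≤ φ a := by
  have hb_eq : b * (a + 1) / (1 + a) = b := by
    rw [add_comm a 1, mul_div_cancel_right₀ _ (by positivity)]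
  rw [hb_eq] at h
  have hba : b < a := by
    by_contra! hab
    have hle : a * (b + 1) / (1 + a) ≤ b := by
      rw [div_le_iff₀ (by positivity)]
      linarith
    rw [max_eq_right hle, max_eq_right hab] at h
    exact (hφ_lt b hb).not_ge h
  have hle : a * (b + 1) / (1 + a) ≤ a := by
    rw [div_le_iff₀ (by positivity)]
    nlinarith
  rw [max_eq_left (max_le hle hba.le)] at h
  exact ⟨hba, h⟩

/-- A nonnegative antitone sequence with `u (n + 1) ≤ φ (u n)` tends to zero when `φ` is
continuous on `[0, ∞)` and `φ t < t` for positive `t`. -/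
theorem tendsto_zero_of_antitone_of_succ_le {φ : ℝ → ℝ} (hφ_cont : ContinuousOn φ (Set.Ici 0))
    (hφ_lt : ∀ t, 0 < t → φ t < t) {u : ℕ → ℝ} (hu_nonneg : ∀ n, 0 ≤ u n)
    (hu_anti : Antitone u) (hu : ∀ n, u (n + 1) ≤ φ (u n)) :
    Filter.Tendsto u Filter.atTop (nhds 0) := by
  have hbdd : BddBelow (Set.range u) := ⟨0, by rintro _ ⟨n, rfl⟩; exact hu_nonneg n⟩
  obtain ⟨L, hL⟩ : ∃ L, Filter.Tendsto u Filter.atTop (nhds L) :=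
    ⟨_, tendsto_atTop_ciInf hu_anti hbdd⟩
  have hL_nonneg : 0 ≤ L := ge_of_tendsto' hL hu_nonneg
  have hφL : Filter.Tendsto (fun n => φ (u n)) Filter.atTop (nhds (φ L)) :=
    (hφ_cont L hL_nonneg).tendsto.comp
      (tendsto_nhdsWithin_iff.2 ⟨hL, Filter.Eventually.of_forall hu_nonneg⟩)
  have hle : L ≤ φ L :=
    le_of_tendsto_of_tendsto' (hL.comp (Filter.tendsto_add_atTop_nat 1)) hφL hu
  obtain rfl : 0 = L := by
    by_contra hne
    exact (hφ_lt L (hL_nonneg.lt_of_ne hne)).not_ge hle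
  exact hL

/-- For the Picard–Jungck sequence `zₙ = A xₙ = B x_{n+1}` of a rational-type contraction
pair on a generalized metric space, the sequence of consecutive distances `d(zₙ, z_{n+1})`
is strictly decreasing and converges to `0`. -/
theorem consecutive_distances_strictAnti_tendsto_zero
    {X : Type*} [Nonempty X] (d : X → X → ℝ)
    (hd_nonneg : ∀ x y, 0 ≤ d x y)
    (hd_eq : ∀ x y, d x y = 0 ↔ x = y)
    (hd_symm : ∀ x y, d x y = d y x)
    (hd_quad : ∀ w x y z : X, w ≠ x → w ≠ y → w ≠ z → x ≠ y → x ≠ z → y ≠ z →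
      d w x ≤ d w y + d y z + d z x)
    (A B : X → X)
    (hAB : Set.range A ⊆ Set.range B)
    (C : ℝ) (hC : 0 ≤ C)
    (φ : ℝ → ℝ)
    (hφ_nonneg : ∀ t, 0 ≤ t → 0 ≤ φ t)
    (hφ_cont : ContinuousOn φ (Set.Ici 0))
    (hφ_mono : MonotoneOn φ (Set.Ici 0))
    (hφ_zero : ∀ t, 0 ≤ t → (φ t = 0 ↔ t = 0))
    (hφ_lt : ∀ t, 0 < t → φ t < t)
    (hcontr : ∀ x y : X,
      d (A x) (A y) ≤
        φ (max (d (B x) (B y))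
            (max (d (B x) (A x) * (d (B y) (A y) + 1) / (1 + d (B x) (B y)))
                 (d (B y) (A y) * (d (B x) (A x) + 1) / (1 + d (B x) (B y)))))
        + C * min (min (d (B x) (A x)) (d (B y) (A y)))
                  (min (d (B x) (A y)) (d (B y) (A x))))
    (x : ℕ → X) (hx : ∀ n, B (x (n + 1)) = A (x n))
    (z : ℕ → X) (hz : ∀ n, z n = A (x n))
    (hne : ∀ n, z n ≠ z (n + 1)) :
    StrictAnti (fun n => d (z n) (z (n + 1))) ∧
    Filter.Tendsto (fun n => d (z n) (z (n + 1))) Filter.atTop (nhds 0) := by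
  have hpos (n : ℕ) : 0 < d (z n) (z (n + 1)) :=
    (hd_nonneg _ _).lt_of_ne fun h => hne n ((hd_eq _ _).1 h.symm)
  have hstep (n : ℕ) : d (z (n + 1)) (z (n + 2)) < d (z n) (z (n + 1)) ∧
      d (z (n + 1)) (z (n + 2)) ≤ φ (d (z n) (z (n + 1))) := by
    have h := hcontr (x (n + 1)) (x (n + 2))
    rw [hx n, hx (n + 1), ← hz n, ← hz (n + 1), ← hz (n + 2),
      (hd_eq (z (n + 1)) (z (n + 1))).2 rfl, min_eq_right (hd_nonneg _ _),
      min_eq_right (le_min (hd_nonneg _ _) (hd_nonneg _ _)), mul_zero, add_zero] at h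
    exact lt_and_le_of_le_rational_max hφ_lt (hpos n) (hpos (n + 1)) h
  have hanti : StrictAnti (fun n => d (z n) (z (n + 1))) :=
    strictAnti_nat_of_succ_lt fun n => (hstep n).1
  exact ⟨hanti, tendsto_zero_of_antitone_of_succ_le hφ_cont hφ_lt (fun n => (hpos n).le)
    hanti.antitone fun n => (hstep n).2⟩
end

section
/- Let (X,d) be a generalized metric space, let A, B : X → X satisfy A(X) ⊆ B(X), and suppose there exist C ≥ 0 and φ : [0,∞) → [0,∞) continuous, nondecreasing, with φ(t) = 0 ⟺ t = 0 and φ(t) < t for t > 0, such that d(Ax,Ay) ≤ φ(M(x,y)) + C·min{d(Bx,Ax), d(By,Ay), d(Bx,Ay), d(By,Ax)} for all x, y ∈ X, where M(x,y) = max{d(Bx,By), d(Bx,Ax)(d(By,Ay)+1)/(1+d(Bx,By)), d(By,Ay)(d(Bx,Ax)+1)/(1+d(Bx,By))}. Let (xₙ) be a sequence in X with B x_{n+1} = A xₙ for all n, set zₙ = A xₙ, and assume the points zₙ are pairwise distinct. Then d(zₙ, z_{n+2}) → 0 as n → ∞. -/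
open Filter Topology in
/-- If `u (n + 1) ≤ φ (v n) + w n`, where `u` and `v` converge to `L`, `w` tends to zero and
`φ t < t` for all positive `t`, then `L = 0`. -/
theorem limit_eq_zero_of_le_comparison {φ : ℝ → ℝ} (hφ_cont : ContinuousOn φ (Set.Ici 0))
    (hφ_lt : ∀ t, 0 < t → φ t < t) {u v w : ℕ → ℝ} {L : ℝ} (hv_nonneg : ∀ n, 0 ≤ v n)
    (hu : Tendsto u atTop (𝓝 L)) (hv : Tendsto v atTop (𝓝 L)) (hw : Tendsto w atTop (𝓝 0))
    (h : ∀ n, u (n + 1) ≤ φ (v n) + w n) : L = 0 := by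
  have hL : 0 ≤ L := ge_of_tendsto' hv hv_nonneg
  have hφv : Tendsto (fun n => φ (v n)) atTop (𝓝 (φ L)) :=
    (hφ_cont L hL).tendsto.comp
      (tendsto_nhdsWithin_iff.2 ⟨hv, Eventually.of_forall hv_nonneg⟩)
  have hle : L ≤ φ L + 0 :=
    le_of_tendsto_of_tendsto' (hu.comp (tendsto_add_atTop_nat 1)) (hφv.add hw) h
  by_contra hne
  linarith [hφ_lt L (lt_of_le_of_ne hL (Ne.symm hne))]

open Filter Topology in
/-- If odd-step distances along a sequence satisfying the quadrilateral inequality are eventually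
uniformly small, then the two-step distances form a Cauchy sequence. -/
theorem cauchySeq_two_step {D : ℕ → ℕ → ℝ} (hsymm : ∀ m n, D m n = D n m)
    (hquad : ∀ i j k l : ℕ, i ≠ j → i ≠ k → i ≠ l → j ≠ k → j ≠ l → k ≠ l →
      D i j ≤ D i k + D k l + D l j)
    (hodd : ∀ ε > 0, ∃ N, ∀ n ≥ N, ∀ k, D n (n + 2 * k + 1) < ε) :
    CauchySeq (fun n => D n (n + 2)) := by
  rw [Metric.cauchySeq_iff]
  intro ε hε
  obtain ⟨N, hN⟩ := hodd (ε / 4) (by positivity)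
  have hsmall : ∀ m n, N ≤ m → N ≤ n → (m + n) % 2 = 1 → D m n < ε / 4 := by
    intro m n hm hn hmn
    rcases le_total m n with h | h
    · obtain ⟨k, rfl⟩ : ∃ k, n = m + 2 * k + 1 := ⟨(n - m) / 2, by omega⟩
      exact hN m hm k
    · obtain ⟨k, rfl⟩ : ∃ k, m = n + 2 * k + 1 := ⟨(m - n) / 2, by omega⟩
      rw [hsymm]
      exact hN n hn k
  have hopp : ∀ m n, N ≤ m → N ≤ n → (m + n) % 2 = 1 →
      D m (m + 2) < D n (n + 2) + ε / 2 := by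
    intro m n hm hn hmn
    have hq := hquad m (m + 2) n (n + 2) (by omega) (by omega) (by omega) (by omega) (by omega)
      (by omega)
    linarith [hsmall m n hm hn hmn, hsmall (n + 2) (m + 2) (by omega) (by omega) (by omega)]
  have hall : ∀ m n, N ≤ m → N ≤ n → D m (m + 2) < D n (n + 2) + ε := by
    intro m n hm hn
    rcases Nat.mod_two_eq_zero_or_one (m + n) with h | h
    · linarith [hopp m (n + 1) hm (by omega) (by omega),
        hopp (n + 1) n (by omega) hn (by omega)]
    · linarith [hopp m n hm hn h]
  refine ⟨N, fun m hm n hn => ?_⟩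
  rw [Real.dist_eq, abs_lt]
  constructor <;> linarith [hall m n hm hn, hall n m hn hm]

/-- For the Picard–Jungck sequence `zₙ = A xₙ = B x_{n+1}` of a rational-type contraction
pair on a generalized metric space, with pairwise distinct terms, `d(zₙ, z_{n+2}) → 0`. -/
theorem two_step_distances_tendsto_zero
    {X : Type*} [Nonempty X] (d : X → X → ℝ)
    (hd_nonneg : ∀ x y, 0 ≤ d x y)
    (hd_eq : ∀ x y, d x y = 0 ↔ x = y)
    (hd_symm : ∀ x y, d x y = d y x)
    (hd_quad : ∀ w x y z : X, w ≠ x → w ≠ y → w ≠ z → x ≠ y → x ≠ z → y ≠ z →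
      d w x ≤ d w y + d y z + d z x)
    (A B : X → X)
    (hAB : Set.range A ⊆ Set.range B)
    (C : ℝ) (hC : 0 ≤ C)
    (φ : ℝ → ℝ)
    (hφ_nonneg : ∀ t, 0 ≤ t → 0 ≤ φ t)
    (hφ_cont : ContinuousOn φ (Set.Ici 0))
    (hφ_mono : MonotoneOn φ (Set.Ici 0))
    (hφ_zero : ∀ t, 0 ≤ t → (φ t = 0 ↔ t = 0))
    (hφ_lt : ∀ t, 0 < t → φ t < t)
    (hcontr : ∀ x y : X,
      d (A x) (A y) ≤
        φ (max (d (B x) (B y))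
            (max (d (B x) (A x) * (d (B y) (A y) + 1) / (1 + d (B x) (B y)))
                 (d (B y) (A y) * (d (B x) (A x) + 1) / (1 + d (B x) (B y)))))
        + C * min (min (d (B x) (A x)) (d (B y) (A y)))
                  (min (d (B x) (A y)) (d (B y) (A x))))
    (x : ℕ → X) (hx : ∀ n, B (x (n + 1)) = A (x n))
    (z : ℕ → X) (hz : ∀ n, z n = A (x n))
    (hne : ∀ m n : ℕ, m ≠ n → z m ≠ z n) :
    Filter.Tendsto (fun n => d (z n) (z (n + 2))) Filter.atTop (nhds 0) := by
  set D : ℕ → ℕ → ℝ := fun m n => d (z m) (z n) with hD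
  have hD_nonneg : ∀ m n, 0 ≤ D m n := fun m n => hd_nonneg _ _
  have hD_symm : ∀ m n, D m n = D n m := fun m n => hd_symm _ _
  have hD_quad : ∀ i j k l : ℕ, i ≠ j → i ≠ k → i ≠ l → j ≠ k → j ≠ l → k ≠ l →
      D i j ≤ D i k + D k l + D l j := fun i j k l h₁ h₂ h₃ h₄ h₅ h₆ =>
    hd_quad _ _ _ _ (hne _ _ h₁) (hne _ _ h₂) (hne _ _ h₃) (hne _ _ h₄) (hne _ _ h₅)
      (hne _ _ h₆)
  have hD_contr : ∀ m n, D (m + 1) (n + 1) ≤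
      φ (max (D m n)
          (max (D m (m + 1) * (D n (n + 1) + 1) / (1 + D m n))
               (D n (n + 1) * (D m (m + 1) + 1) / (1 + D m n))))
      + C * min (min (D m (m + 1)) (D n (n + 1))) (min (D m (n + 1)) (D n (m + 1))) := by
    intro m n
    have h := hcontr (x (m + 1)) (x (n + 1))
    simpa only [hx, ← hz] using h
  have ha_pos : ∀ n, 0 < D n (n + 1) := fun n =>
    lt_of_le_of_ne (hD_nonneg _ _) fun h => hne n (n + 1) (by omega) ((hd_eq _ _).1 h.symm)
  have ha_step : ∀ n, D (n + 1) (n + 1 + 1) < D n (n + 1) ∧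
      D (n + 1) (n + 1 + 1) ≤ φ (D n (n + 1)) := by
    intro n
    have h := hD_contr n (n + 1)
    have h_self : D (n + 1) (n + 1) = 0 := (hd_eq _ _).2 rfl
    have h_min : min (min (D n (n + 1)) (D (n + 1) (n + 1 + 1)))
        (min (D n (n + 1 + 1)) (D (n + 1) (n + 1))) ≤ 0 :=
      ((min_le_right _ _).trans (min_le_right _ _)).trans h_self.le
    have h_mul := mul_nonpos_of_nonneg_of_nonpos hC h_min
    have hp := ha_pos n
    have hq := ha_pos (n + 1)
    generalize D n (n + 1) = p at *
    generalize D (n + 1) (n + 1 + 1) = q at *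
    have h_le : ∀ t, 0 ≤ t → p ≤ t → q ≤ t → q ≤ φ t := by
      intro t ht hpt hqt
      have h_max : max p (max (p * (q + 1) / (1 + p)) (q * (p + 1) / (1 + p))) ≤ t := by
        refine max_le hpt (max_le ?_ ?_) <;> rw [div_le_iff₀ (by positivity)] <;> nlinarith
      linarith [hφ_mono (le_max_of_le_left hp.le : (0 : ℝ) ≤ _) ht h_max]
    have hlt : q < p := by
      by_contra! hpq
      linarith [h_le q hq.le hpq le_rfl, hφ_lt q hq]
    exact ⟨hlt, h_le p hp.le le_rfl hlt.le⟩
  have ha_anti : Antitone (fun n => D n (n + 1)) :=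
    antitone_nat_of_succ_le fun n => (ha_step n).1.le
  have ha_tendsto : Filter.Tendsto (fun n => D n (n + 1)) Filter.atTop (nhds 0) := by
    have hlim := tendsto_atTop_ciInf ha_anti ⟨0, by rintro _ ⟨n, rfl⟩; exact hD_nonneg _ _⟩
    have hzero := limit_eq_zero_of_le_comparison hφ_cont hφ_lt (fun n => (ha_pos n).le) hlim hlim
      (tendsto_const_nhds (x := (0 : ℝ))) (fun n => by simpa using (ha_step n).2)
    rwa [hzero] at hlim
  have h_contr_le : ∀ m n t, m ≤ n → D m n ≤ t → D m (m + 1) * (D 0 1 + 1) ≤ t →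
      D (m + 1) (n + 1) ≤ φ t + C * D m (m + 1) := by
    intro m n t hmn hmt ht
    have h := hD_contr m n
    have h_min := mul_le_mul_of_nonneg_left
      ((min_le_left _ (min (D m (n + 1)) (D n (m + 1)))).trans
        (min_le_left (D m (m + 1)) (D n (n + 1)))) hC
    have hm := ha_pos m
    have hn := ha_pos n
    have hnm : D n (n + 1) ≤ D m (m + 1) := ha_anti hmn
    have hm0 : D m (m + 1) ≤ D 0 1 := ha_anti (Nat.zero_le m)
    have hmn0 := hD_nonneg m n
    have h_max : max (D m n) (max (D m (m + 1) * (D n (n + 1) + 1) / (1 + D m n))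
        (D n (n + 1) * (D m (m + 1) + 1) / (1 + D m n))) ≤ t := by
      refine max_le hmt (max_le ?_ ?_)
      · refine (div_le_self (by positivity) (by linarith)).trans (le_trans ?_ ht)
        gcongr
        exact hnm.trans hm0
      · refine (div_le_self (by positivity) (by linarith)).trans (le_trans ?_ ht)
        gcongr
    linarith [hφ_mono (le_max_of_le_left hmn0 : (0 : ℝ) ≤ _) (hmn0.trans hmt) h_max]
  have h_odd : ∀ ε > 0, ∃ N, ∀ n ≥ N, ∀ k, D n (n + 2 * k + 1) < ε := by
    intro ε hε
    have h₁ : ∀ᶠ n in Filter.atTop, D n (n + 1) * (D 0 1 + 1) < ε :=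
      (ha_tendsto.mul_const (D 0 1 + 1)).eventually_lt_const (by simpa using hε)
    have h₂ : ∀ᶠ n in Filter.atTop, D n (n + 1) * (C + 2) < ε - φ ε :=
      (ha_tendsto.mul_const (C + 2)).eventually_lt_const (by simpa using hφ_lt ε hε)
    obtain ⟨N, hN⟩ := Filter.eventually_atTop.1
      ((h₁.and h₂).and (ha_tendsto.eventually_lt_const hε))
    refine ⟨N, fun n hn k => ?_⟩
    obtain ⟨⟨hn₁, hn₂⟩, hn₃⟩ := hN n hn
    induction k with
    | zero => exact hn₃
    | succ k ih =>
      have hq := hD_quad n (n + 2 * k + 3) (n + 1) (n + 2 * k + 2) (by omega) (by omega)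
        (by omega) (by omega) (by omega) (by omega)
      have hc : D (n + 1) (n + 2 * k + 2) ≤ φ ε + C * D n (n + 1) :=
        h_contr_le n (n + 2 * k + 1) ε (by omega) ih.le hn₁.le
      have hlast : D (n + 2 * k + 2) (n + 2 * k + 3) ≤ D n (n + 1) :=
        ha_anti (by omega : n ≤ n + 2 * k + 2)
      change D n (n + 2 * k + 3) < ε
      linarith
  obtain ⟨L, hL⟩ := cauchySeq_tendsto_of_complete (cauchySeq_two_step hD_symm hD_quad h_odd)
  have hL_nonneg : 0 ≤ L := ge_of_tendsto' hL fun n => hD_nonneg _ _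
  have hv : Filter.Tendsto (fun n => max (D n (n + 2)) (D n (n + 1) * (D 0 1 + 1))) Filter.atTop (nhds L) := by
    simpa [max_eq_left hL_nonneg] using hL.max (ha_tendsto.mul_const (D 0 1 + 1))
  have hzero : L = 0 :=
    limit_eq_zero_of_le_comparison hφ_cont hφ_lt (fun n => le_max_of_le_left (hD_nonneg _ _))
      hL hv (by simpa using ha_tendsto.const_mul C)
      (fun n => h_contr_le n (n + 2) _ (by omega) (le_max_left _ _) (le_max_right _ _))
  rwa [hzero] at hL
end

section
/- Let (X,d) be a generalized metric space, let A, B : X → X satisfy A(X) ⊆ B(X), and suppose there exist C ≥ 0 and φ : [0,∞) → [0,∞) continuous, nondecreasing, with φ(t) = 0 ⟺ t = 0 and φ(t) < t for t > 0, such that d(Ax,Ay) ≤ φ(M(x,y)) + C·min{d(Bx,Ax), d(By,Ay), d(Bx,Ay), d(By,Ax)} for all x, y ∈ X, where M(x,y) = max{d(Bx,By), d(Bx,Ax)(d(By,Ay)+1)/(1+d(Bx,By)), d(By,Ay)(d(Bx,Ax)+1)/(1+d(Bx,By))}. Let (xₙ) be a sequence in X with B x_{n+1} = A xₙ for all n,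 set zₙ = A xₙ, and assume the points zₙ are pairwise distinct. Then (zₙ) is a Cauchy sequence in (X,d), i.e., for every ε > 0 there is K such that d(z_r, z_s) < ε for all r > s ≥ K. -/
open Filter Topology

/-- A bounded nonnegative sequence satisfying `a (n + 1) ≤ φ (max (a n) (s n)) + c n`, with `φ` a
continuous comparison function and `s`, `c` null sequences, tends to zero. -/
lemma tendsto_zero_of_le_comparison_add {φ : ℝ → ℝ}
    (hφ_cont : ContinuousOn φ (Set.Ici 0)) (hφ_mono : MonotoneOn φ (Set.Ici 0))
    (hφ_lt : ∀ t, 0 < t → φ t < t) {a s c : ℕ → ℝ} {T : ℝ} (ha : ∀ n, 0 ≤ a n)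
    (hT : ∀ᶠ n in atTop, a n ≤ T)
    (hs : Tendsto s atTop (𝓝 0)) (hc : Tendsto c atTop (𝓝 0))
    (h : ∀ n, a (n + 1) ≤ φ (max (a n) (s n)) + c n) : Tendsto a atTop (𝓝 0) := by
  have entry : ∀ ε > 0, ∀ N, ∃ n ≥ N, a n ≤ ε := by
    intro ε hε N
    by_contra! hcon
    have hφT : ContinuousOn (fun t => t - φ t) (Set.Icc ε (max ε T)) :=
      continuousOn_id.sub (hφ_cont.mono fun t ht => hε.le.trans ht.1)
    obtain ⟨t₀, ht₀, hmin⟩ := isCompact_Icc.exists_isMinOn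
      (Set.nonempty_Icc.2 (le_max_left ε T)) hφT
    have hμ : 0 < t₀ - φ t₀ := sub_pos.2 (hφ_lt t₀ (hε.trans_le ht₀.1))
    obtain ⟨N₁, hN₁⟩ := eventually_atTop.1
      (hT.and ((hs.eventually_le_const hε).and (hc.eventually_le_const (half_pos hμ))))
    have step : ∀ n ≥ max N N₁, a (n + 1) ≤ a n - (t₀ - φ t₀) / 2 := by
      intro n hn
      obtain ⟨h₁, h₂, h₃⟩ := hN₁ n ((le_max_right _ _).trans hn)
      have hlt := hcon n ((le_max_left _ _).trans hn)
      have hstep := h n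
      rw [max_eq_left (h₂.trans hlt.le)] at hstep
      have : t₀ - φ t₀ ≤ a n - φ (a n) := hmin ⟨hlt.le, h₁.trans (le_max_right _ _)⟩
      linarith
    have descent : ∀ j : ℕ, a (max N N₁ + j) ≤ a (max N N₁) - j * ((t₀ - φ t₀) / 2) := by
      intro j
      induction j with
      | zero => simp
      | succ j ih =>
        have := step (max N N₁ + j) (Nat.le_add_right _ _)
        rw [← add_assoc]
        push_cast
        linarith
    obtain ⟨j, hj⟩ := exists_nat_gt (a (max N N₁) / ((t₀ - φ t₀) / 2))
    rw [div_lt_iff₀ (half_pos hμ)] at hj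
    linarith [descent j, ha (max N N₁ + j)]
  rw [Metric.tendsto_atTop]
  intro ε hε
  have hε' := half_pos hε
  obtain ⟨N, hN⟩ := eventually_atTop.1 ((hs.eventually_le_const hε').and
    (hc.eventually_le_const (sub_pos.2 (hφ_lt _ hε'))))
  obtain ⟨n₀, hn₀, hle⟩ := entry (ε / 2) hε' N
  refine ⟨n₀, fun n hn => ?_⟩
  have stay : a n ≤ ε / 2 := by
    induction n, hn using Nat.le_induction with
    | base => exact hle
    | succ n hn ih =>
      obtain ⟨h₁, h₂⟩ := hN n (hn₀.trans hn)
      have : φ (max (a n) (s n)) ≤ φ (ε / 2) :=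
        hφ_mono ((ha n).trans (le_max_left _ _)) hε'.le (max_le ih h₁)
      linarith [h n]
  rw [Real.dist_eq, sub_zero, abs_of_nonneg (ha n)]
  linarith

/-- For a doubly indexed distance satisfying the quadrilateral inequality and a shift
contraction, a uniform bound for one gap propagates to all larger gaps of the same parity. -/
lemma gap_bound_of_shift_contraction {D : ℕ → ℕ → ℝ} {φ : ℝ → ℝ} {C : ℝ} (hC : 0 ≤ C)
    (hφ_mono : MonotoneOn φ (Set.Ici 0)) (hφ_lt : ∀ t, 0 < t → φ t < t)
    (hD : ∀ m n, 0 ≤ D m n)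
    (hquad : ∀ i j k l : ℕ, i ≠ j → i ≠ k → i ≠ l → j ≠ k → j ≠ l → k ≠ l →
      D i j ≤ D i k + D k l + D l j)
    (hshift : ∀ m n, D (m + 1) (n + 1) ≤
      φ (max (D m n) (max (D m (m + 1) * (D n (n + 1) + 1)) (D n (n + 1) * (D m (m + 1) + 1))))
        + C * D m (m + 1))
    (hδ : Tendsto (fun n => D n (n + 1)) atTop (𝓝 0)) {ε : ℝ} (hε : 0 < ε) :
    ∃ N₀, ∀ N ≥ N₀, ∀ k ≥ 1, (∀ n ≥ N, D n (n + k) ≤ ε) →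
      ∀ j, ∀ n ≥ N, D n (n + (k + 2 * j)) ≤ ε := by
  have hgap : 0 < ε - φ ε := sub_pos.2 (hφ_lt ε hε)
  obtain ⟨N₀, hN₀⟩ := eventually_atTop.1 ((hδ.eventually_le_const one_pos).and
    ((hδ.eventually_le_const (half_pos hε)).and
      ((hδ.eventually_le_const (div_pos hgap (by positivity : 0 < 2 + C))))))
  refine ⟨N₀, fun N hN k hk hbase j => ?_⟩
  induction j with
  | zero => simpa using hbase
  | succ j ih =>
    intro n hn
    set g := k + 2 * j with hg
    obtain ⟨h₁, h₂, h₃⟩ := hN₀ n (hN.trans hn)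
    obtain ⟨h₄, h₅, -⟩ := hN₀ (n + g) (by omega)
    obtain ⟨-, -, h₇⟩ := hN₀ (n + g + 1) (by omega)
    have hδn := hD n (n + 1)
    have hδg := hD (n + g) (n + g + 1)
    have hs := hshift n (n + g)
    have hφ := hφ_mono (a := max (D n (n + g)) (max (D n (n + 1) * (D (n + g) (n + g + 1) + 1))
      (D (n + g) (n + g + 1) * (D n (n + 1) + 1)))) (b := ε)
      ((hD _ _).trans (le_max_left _ _)) hε.le
      (max_le (ih n hn) (max_le (by nlinarith) (by nlinarith)))
    have hq := hquad n (n + g + 2) (n + 1) (n + g + 1) (by omega) (by omega) (by omega)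
      (by omega) (by omega) (by omega)
    have heq : n + (k + 2 * (j + 1)) = n + g + 2 := by omega
    rw [heq]
    have hmax : D n (n + 1) + D (n + g + 1) (n + g + 2) + C * D n (n + 1) ≤ ε - φ ε := by
      have h₈ := mul_le_mul_of_nonneg_left h₃ hC
      have h₉ : (2 + C) * ((ε - φ ε) / (2 + C)) = ε - φ ε := by field_simp
      linarith
    linarith

/-- The Picard–Jungck sequence `zₙ = A xₙ = B x_{n+1}` of a rational-type contraction pair
on a generalized metric space, with pairwise distinct terms, is a Cauchy sequence. -/
theorem picard_jungck_sequence_cauchy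
    {X : Type*} [Nonempty X] (d : X → X → ℝ)
    (hd_nonneg : ∀ x y, 0 ≤ d x y)
    (hd_eq : ∀ x y, d x y = 0 ↔ x = y)
    (hd_symm : ∀ x y, d x y = d y x)
    (hd_quad : ∀ w x y z : X, w ≠ x → w ≠ y → w ≠ z → x ≠ y → x ≠ z → y ≠ z →
      d w x ≤ d w y + d y z + d z x)
    (A B : X → X)
    (hAB : Set.range A ⊆ Set.range B)
    (C : ℝ) (hC : 0 ≤ C)
    (φ : ℝ → ℝ)
    (hφ_nonneg : ∀ t, 0 ≤ t → 0 ≤ φ t)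
    (hφ_cont : ContinuousOn φ (Set.Ici 0))
    (hφ_mono : MonotoneOn φ (Set.Ici 0))
    (hφ_zero : ∀ t, 0 ≤ t → (φ t = 0 ↔ t = 0))
    (hφ_lt : ∀ t, 0 < t → φ t < t)
    (hcontr : ∀ x y : X,
      d (A x) (A y) ≤
        φ (max (d (B x) (B y))
            (max (d (B x) (A x) * (d (B y) (A y) + 1) / (1 + d (B x) (B y)))
                 (d (B y) (A y) * (d (B x) (A x) + 1) / (1 + d (B x) (B y)))))
        + C * min (min (d (B x) (A x)) (d (B y) (A y)))
                  (min (d (B x) (A y)) (d (B y) (A x))))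
    (x : ℕ → X) (hx : ∀ n, B (x (n + 1)) = A (x n))
    (z : ℕ → X) (hz : ∀ n, z n = A (x n))
    (hne : ∀ m n : ℕ, m ≠ n → z m ≠ z n) :
    ∀ ε > (0 : ℝ), ∃ K : ℕ, ∀ r s : ℕ, K ≤ s → s < r → d (z r) (z s) < ε := by
  let D : ℕ → ℕ → ℝ := fun m n => d (z m) (z n)
  have hD : ∀ m n, 0 ≤ D m n := fun m n => hd_nonneg _ _
  have hDsymm : ∀ m n, D m n = D n m := fun m n => hd_symm _ _
  have hDself : ∀ n, D n n = 0 := fun n => (hd_eq _ _).2 rfl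
  have hDpos : ∀ n, 0 < D n (n + 1) := fun n =>
    (hD _ _).lt_of_ne' fun h => hne n (n + 1) (by omega) ((hd_eq _ _).1 h)
  have hquad : ∀ i j k l : ℕ, i ≠ j → i ≠ k → i ≠ l → j ≠ k → j ≠ l → k ≠ l →
      D i j ≤ D i k + D k l + D l j := fun i j k l h₁ h₂ h₃ h₄ h₅ h₆ =>
    hd_quad _ _ _ _ (hne _ _ h₁) (hne _ _ h₂) (hne _ _ h₃) (hne _ _ h₄) (hne _ _ h₅) (hne _ _ h₆)
  have hkey : ∀ m n, D (m + 1) (n + 1) ≤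
      φ (max (D m n) (max (D m (m + 1) * (D n (n + 1) + 1) / (1 + D m n))
        (D n (n + 1) * (D m (m + 1) + 1) / (1 + D m n))))
      + C * min (min (D m (m + 1)) (D n (n + 1))) (min (D m (n + 1)) (D n (m + 1))) := by
    intro m n
    have := hcontr (x (m + 1)) (x (n + 1))
    simpa only [hx, ← hz] using this
  have hshift : ∀ m n, D (m + 1) (n + 1) ≤
      φ (max (D m n) (max (D m (m + 1) * (D n (n + 1) + 1)) (D n (n + 1) * (D m (m + 1) + 1))))
        + C * D m (m + 1) := by
    intro m n
    refine (hkey m n).trans (add_le_add (hφ_mono ((hD _ _).trans (le_max_left _ _))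
      ((hD _ _).trans (le_max_left _ _)) ?_) (mul_le_mul_of_nonneg_left
        ((min_le_left _ _).trans (min_le_left _ _)) hC))
    have h₀ := hD m n
    have h₁ := hD m (m + 1)
    have h₂ := hD n (n + 1)
    gcongr
    · exact div_le_self (by positivity) (by linarith)
    · exact div_le_self (by positivity) (by linarith)
  have hrec : ∀ n, D (n + 1) (n + 2) ≤
      φ (max (D n (n + 1)) (D (n + 1) (n + 2))) := by
    intro n
    have h₁ := hDpos n
    have h₂ := hDpos (n + 1)
    have hmin : min (min (D n (n + 1)) (D (n + 1) (n + 1 + 1)))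
        (min (D n (n + 1 + 1)) (D (n + 1) (n + 1))) ≤ 0 :=
      (min_le_right _ _).trans ((min_le_right _ _).trans (hDself _).le)
    refine (hkey n (n + 1)).trans ?_
    have hφ := hφ_mono (a := max (D n (n + 1))
      (max (D n (n + 1) * (D (n + 1) (n + 1 + 1) + 1) / (1 + D n (n + 1)))
        (D (n + 1) (n + 1 + 1) * (D n (n + 1) + 1) / (1 + D n (n + 1)))))
      (b := max (D n (n + 1)) (D (n + 1) (n + 2)))
      (h₁.le.trans (le_max_left _ _)) (h₁.le.trans (le_max_left _ _)) (by
        refine max_le (le_max_left _ _) (max_le ?_ ?_)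
        · rw [div_le_iff₀ (by positivity)]
          rcases le_total (D n (n + 1)) (D (n + 1) (n + 2)) with h | h
          · rw [max_eq_right h]
            linarith
          · rw [max_eq_left h]
            nlinarith
        · rw [div_le_iff₀ (by positivity), add_comm 1 (D n (n + 1))]
          exact mul_le_mul_of_nonneg_right (le_max_right _ _) (by positivity))
    linarith [mul_nonpos_of_nonneg_of_nonpos hC hmin]
  have hlt : ∀ n, D (n + 1) (n + 2) < D n (n + 1) := by
    intro n
    by_contra! hle
    have := hrec n
    rw [max_eq_right hle] at this
    exact absurd this (hφ_lt _ (hDpos (n + 1))).not_ge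
  have hδ : Tendsto (fun n => D n (n + 1)) atTop (𝓝 0) := by
    have hanti : Antitone fun n => D n (n + 1) := antitone_nat_of_succ_le fun n => (hlt n).le
    refine tendsto_zero_of_le_comparison_add hφ_cont hφ_mono hφ_lt (T := D 0 1)
      (s := fun _ => 0) (c := fun _ => 0) (fun n => hD _ _)
      (.of_forall fun n => hanti (Nat.zero_le n)) tendsto_const_nhds tendsto_const_nhds
      fun n => ?_
    have := hrec n
    rw [max_eq_left (hlt n).le] at this
    rw [max_eq_left (hD n (n + 1)), add_zero]
    exact this
  have hgaps := fun (ε : ℝ) (hε : 0 < ε) =>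
    gap_bound_of_shift_contraction hC hφ_mono hφ_lt hD hquad hshift hδ hε
  have hodd : ∀ ε > 0, ∃ N, ∀ n ≥ N, ∀ j, D n (n + (1 + 2 * j)) ≤ ε := by
    intro ε hε
    obtain ⟨N₀, hN₀⟩ := hgaps ε hε
    obtain ⟨N₁, hN₁⟩ := eventually_atTop.1 (hδ.eventually_le_const hε)
    exact ⟨max N₀ N₁, fun n hn j => hN₀ _ (le_max_left _ _) 1 le_rfl
      (fun m hm => hN₁ m ((le_max_right _ _).trans hm)) j n hn⟩
  have hbdd : ∃ T, ∀ᶠ n in atTop, D n (n + 2) ≤ T := by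
    obtain ⟨N, hN⟩ := hodd 1 one_pos
    have hbridge : ∀ p ≥ N, ∀ j, D (p + 3 + 2 * j) (p + 3 + 2 * j + 2) ≤ D p (p + 2) + 2 := by
      intro p hp j
      have hq := hquad (p + 3 + 2 * j) (p + 3 + 2 * j + 2) p (p + 2) (by omega) (by omega)
        (by omega) (by omega) (by omega) (by omega)
      have h₁ := hN p hp (j + 1)
      have h₂ := hN (p + 2) (by omega) (j + 1)
      rw [show p + (1 + 2 * (j + 1)) = p + 3 + 2 * j by omega, hDsymm] at h₁
      rw [show p + 2 + (1 + 2 * (j + 1)) = p + 3 + 2 * j + 2 by omega] at h₂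
      linarith
    refine ⟨max (D N (N + 2)) (D (N + 1) (N + 1 + 2)) + 2,
      eventually_atTop.2 ⟨N + 3, fun n hn => ?_⟩⟩
    obtain ⟨j, hj | hj⟩ : ∃ j, n = N + 3 + 2 * j ∨ n = N + 1 + 3 + 2 * j :=
      ⟨(n - (N + 3)) / 2, by omega⟩
    · have := hbridge N le_rfl j
      rw [← hj] at this
      linarith [le_max_left (D N (N + 2)) (D (N + 1) (N + 1 + 2))]
    · have := hbridge (N + 1) (by omega) j
      rw [← hj] at this
      linarith [le_max_right (D N (N + 2)) (D (N + 1) (N + 1 + 2))]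
  have he : Tendsto (fun n => D n (n + 2)) atTop (𝓝 0) := by
    obtain ⟨T, hT⟩ := hbdd
    have hδ₂ : Tendsto (fun n => D (n + 2) (n + 2 + 1)) atTop (𝓝 0) :=
      hδ.comp (tendsto_add_atTop_nat 2)
    refine tendsto_zero_of_le_comparison_add hφ_cont hφ_mono hφ_lt (T := T)
      (s := fun n => max (D n (n + 1) * (D (n + 2) (n + 2 + 1) + 1))
        (D (n + 2) (n + 2 + 1) * (D n (n + 1) + 1)))
      (c := fun n => C * D n (n + 1)) (fun n => hD _ _) hT ?_ ?_ fun n => hshift n (n + 2)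
    · simpa using (hδ.mul (hδ₂.add_const 1)).max (hδ₂.mul (hδ.add_const 1))
    · simpa using hδ.const_mul C
  intro ε hε
  obtain ⟨N₁, hN₁⟩ := hodd (ε / 2) (half_pos hε)
  obtain ⟨N₂, hN₂⟩ := hgaps (ε / 2) (half_pos hε)
  obtain ⟨N₃, hN₃⟩ := eventually_atTop.1 (he.eventually_le_const (half_pos hε))
  refine ⟨max N₁ (max N₂ N₃), fun r s hs hsr => ?_⟩
  have hle : D s r ≤ ε / 2 := by
    obtain ⟨j, hj | hj⟩ : ∃ j, r = s + (1 + 2 * j) ∨ r = s + (2 + 2 * j) :=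
      ⟨(r - s - 1) / 2, by omega⟩
    · rw [hj]
      exact hN₁ s (by omega) j
    · rw [hj]
      exact hN₂ s (by omega) 2 (by omega) (fun n hn => hN₃ n (by omega)) j s le_rfl
  rw [hd_symm]
  exact hle.trans_lt (half_lt_self hε)
end

section
/- Let (X,d) be a generalized metric space and let A, B : X → X be self-mappings. Suppose there exist C ≥ 0 and φ : [0,∞) → [0,∞) continuous, nondecreasing, with φ(t) = 0 ⟺ t = 0 and φ(t) < t for t > 0, such that d(Ax,Ay) ≤ φ(M(x,y)) + C·min{d(Bx,Ax), d(By,Ay), d(Bx,Ay), d(By,Ax)} for all x, y ∈ X, where M(x,y) = max{d(Bx,By), d(Bx,Ax)(d(By,Ay)+1)/(1+d(Bx,By)), d(By,Ay)(d(Bx,Ax)+1)/(1+d(Bx,By))}. If u, v ∈ X satisfy Au = Bu and Av = Bv, then Au = Av; i.e., A and B have at most one point of coincidence. -/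
/-- A rational-type contraction pair `A`, `B` on a generalized metric space has at most one
point of coincidence: if `Au = Bu` and `Av = Bv`, then `Au = Av`. -/
theorem point_of_coincidence_unique
    {X : Type*} [Nonempty X] (d : X → X → ℝ)
    (hd_nonneg : ∀ x y, 0 ≤ d x y)
    (hd_eq : ∀ x y, d x y = 0 ↔ x = y)
    (hd_symm : ∀ x y, d x y = d y x)
    (hd_quad : ∀ w x y z : X, w ≠ x → w ≠ y → w ≠ z → x ≠ y → x ≠ z → y ≠ z →
      d w x ≤ d w y + d y z + d z x)
    (A B : X → X)
    (C : ℝ) (hC : 0 ≤ C)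
    (φ : ℝ → ℝ)
    (hφ_nonneg : ∀ t, 0 ≤ t → 0 ≤ φ t)
    (hφ_cont : ContinuousOn φ (Set.Ici 0))
    (hφ_mono : MonotoneOn φ (Set.Ici 0))
    (hφ_zero : ∀ t, 0 ≤ t → (φ t = 0 ↔ t = 0))
    (hφ_lt : ∀ t, 0 < t → φ t < t)
    (hcontr : ∀ x y : X,
      d (A x) (A y) ≤
        φ (max (d (B x) (B y))
            (max (d (B x) (A x) * (d (B y) (A y) + 1) / (1 + d (B x) (B y)))
                 (d (B y) (A y) * (d (B x) (A x) + 1) / (1 + d (B x) (B y)))))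
        + C * min (min (d (B x) (A x)) (d (B y) (A y)))
                  (min (d (B x) (A y)) (d (B y) (A x))))
    (u v : X) (hu : A u = B u) (hv : A v = B v) :
    A u = A v := by
  by_contra hne
  have hself : ∀ x, d x x = 0 := fun x => (hd_eq x x).2 rfl
  have hpos : 0 < d (B u) (B v) :=
    (hd_nonneg _ _).lt_of_ne fun h => hne (by rw [hu, hv]; exact (hd_eq _ _).1 h.symm)
  have h := hcontr u v
  rw [hu, hv, hself, hself, hd_symm (B v) (B u)] at h
  simp only [zero_mul, zero_div, max_self, min_self, max_eq_left hpos.le,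
    min_eq_left hpos.le, mul_zero, add_zero] at h
  exact (hφ_lt _ hpos).not_ge h
end

section
/- Let (X,d) be a generalized metric space and let A, B : X → X be self-mappings with A(X) ⊆ B(X) such that (B(X), d) is a complete generalized metric space. Suppose there exist constants a₁, a₂, a₃, L ≥ 0 with a₁ + a₂ + a₃ < 1 such that for all x, y ∈ X: d(Ax,Ay) ≤ a₁·d(Bx,By) + a₂·d(Bx,Ax)(d(By,Ay)+1)/(1+d(Bx,By)) + a₃·d(By,Ay)(d(Bx,Ax)+1)/(1+d(Bx,By)) + L·min{d(Bx,Ax), d(By,Ay), d(Bx,Ay), d(By,Ax)}. Then A and B have a unique point of coincidence in X, and if A and B are weakly compatible, they have a unique common fixed point. -/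
open Filter Topology

/-- A real number `t` bounded by the rational expression in `s` and `t` is at most
`(a₁ + a₂) / (1 - a₃) * s`. -/
theorem le_mul_of_le_rational {a₁ a₂ a₃ s t : ℝ} (ha₁ : 0 ≤ a₁) (ha₂ : 0 ≤ a₂)
    (hsum : a₁ + a₂ + a₃ < 1) (hs : 0 ≤ s)
    (h : t ≤ a₁ * s + a₂ * (s * (t + 1) / (1 + s)) + a₃ * (t * (s + 1) / (1 + s))) :
    t ≤ (a₁ + a₂) / (1 - a₃) * s := by
  have hs' : 0 < 1 + s := by linarith
  have ht : t * (s + 1) / (1 + s) = t := by field_simp; ring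
  rw [ht] at h
  have hts : t ≤ s := by
    by_contra! hlt
    have : s * (t + 1) / (1 + s) ≤ t := by
      rw [div_le_iff₀ hs']; nlinarith
    have := mul_le_mul_of_nonneg_left this ha₂
    have := mul_le_mul_of_nonneg_left hlt.le ha₁
    nlinarith
  have h1 : s * (t + 1) / (1 + s) ≤ s := by
    rw [div_le_iff₀ hs']; nlinarith
  have := mul_le_mul_of_nonneg_left h1 ha₂
  rw [div_mul_eq_mul_div, le_div_iff₀ (by linarith)]
  linarith

/-- Existence of a coincidence point for a rational-type contraction in a generalized metric
space. -/
theorem exists_coincidence_of_rational_contraction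
    {X : Type*} [Nonempty X] (d : X → X → ℝ)
    (hd_nonneg : ∀ x y, 0 ≤ d x y)
    (hd_eq : ∀ x y, d x y = 0 ↔ x = y)
    (hd_symm : ∀ x y, d x y = d y x)
    (hd_quad : ∀ w x y z : X, w ≠ x → w ≠ y → w ≠ z → x ≠ y → x ≠ z → y ≠ z →
      d w x ≤ d w y + d y z + d z x)
    (A B : X → X)
    (hAB : Set.range A ⊆ Set.range B)
    (hcomplete : ∀ s : ℕ → X, (∀ n, s n ∈ Set.range B) →
      (∀ ε > (0 : ℝ), ∃ K : ℕ, ∀ r s', K ≤ s' → s' < r → d (s r) (s s') < ε) →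
      ∃ x ∈ Set.range B, Tendsto (fun n => d (s n) x) atTop (𝓝 0))
    (a₁ a₂ a₃ L : ℝ)
    (ha₁ : 0 ≤ a₁) (ha₂ : 0 ≤ a₂) (ha₃ : 0 ≤ a₃) (hL : 0 ≤ L)
    (hsum : a₁ + a₂ + a₃ < 1)
    (hcontr : ∀ x y : X,
      d (A x) (A y) ≤
        a₁ * d (B x) (B y)
        + a₂ * (d (B x) (A x) * (d (B y) (A y) + 1) / (1 + d (B x) (B y)))
        + a₃ * (d (B y) (A y) * (d (B x) (A x) + 1) / (1 + d (B x) (B y)))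
        + L * min (min (d (B x) (A x)) (d (B y) (A y)))
                  (min (d (B x) (A y)) (d (B y) (A x)))) :
    ∃ u : X, A u = B u := by
  by_contra! hne
  have hweak : ∀ x y, d (A x) (A y) ≤ a₁ * d (B x) (B y)
      + a₂ * (d (B x) (A x) * (d (B y) (A y) + 1))
      + a₃ * (d (B y) (A y) * (d (B x) (A x) + 1)) + L * d (B x) (A x) := by
    intro x y
    refine (hcontr x y).trans ?_
    have h1 : 1 ≤ 1 + d (B x) (B y) := by linarith [hd_nonneg (B x) (B y)]
    have hx := hd_nonneg (B x) (A x)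
    have hy := hd_nonneg (B y) (A y)
    gcongr
    · exact div_le_self (by positivity) h1
    · exact div_le_self (by positivity) h1
    · exact (min_le_left _ _).trans (min_le_left _ _)
  obtain ⟨x₀⟩ := ‹Nonempty X›
  set h : X → X := Function.invFun B
  have hBh : ∀ z ∈ Set.range B, B (h z) = z := fun z hz => Function.invFun_eq hz
  obtain ⟨y, hy0, hysucc⟩ : ∃ y : ℕ → X, y 0 = B x₀ ∧ ∀ n, y (n + 1) = A (h (y n)) :=
    ⟨fun n => (fun z => A (h z))^[n] (B x₀), rfl,
      fun n => Function.iterate_succ_apply' (fun z => A (h z)) n _⟩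
  have hyB : ∀ n, y n ∈ Set.range B := by
    rintro (_ | n)
    · exact ⟨x₀, hy0.symm⟩
    · rw [hysucc]; exact hAB ⟨_, rfl⟩
  have hB : ∀ n, B (h (y n)) = y n := fun n => hBh _ (hyB n)
  have hA : ∀ n, A (h (y n)) = y (n + 1) := fun n => (hysucc n).symm
  set e : ℕ → ℝ := fun n => d (y n) (y (n + 1)) with he
  have he_pos : ∀ n, 0 < e n := fun n =>
    lt_of_le_of_ne (hd_nonneg _ _) fun h0 => hne (h (y n)) <| by
      rw [hA, hB]; exact ((hd_eq _ _).1 h0.symm).symm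
  set q := (a₁ + a₂) / (1 - a₃) with hq
  have hq0 : 0 ≤ q := div_nonneg (by linarith) (by linarith)
  have hq1 : q < 1 := by rw [hq, div_lt_one] <;> linarith
  have hstep : ∀ n, e (n + 1) ≤ q * e n := by
    intro n
    refine le_mul_of_le_rational ha₁ ha₂ hsum (he_pos n).le ?_
    have := hcontr (h (y n)) (h (y (n + 1)))
    have hmin : min (min (e n) (e (n + 1))) (min (d (y n) (y (n + 1 + 1))) 0) = 0 := by
      rw [min_eq_right (hd_nonneg _ _), min_eq_right (le_min (he_pos _).le (he_pos _).le)]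
    rwa [hA, hA, hB, hB, (hd_eq (y (n + 1)) (y (n + 1))).2 rfl, hmin, mul_zero, add_zero] at this
  have he_anti : StrictAnti e := strictAnti_nat_of_succ_lt fun n =>
    (hstep n).trans_lt (by nlinarith [he_pos n])
  have he_lim : Tendsto e atTop (𝓝 0) := by
    have hle : ∀ n, e n ≤ q ^ n * e 0 := by
      intro n
      induction n with
      | zero => simp
      | succ n ih =>
        calc e (n + 1) ≤ q * e n := hstep n
          _ ≤ q * (q ^ n * e 0) := by gcongr
          _ = q ^ (n + 1) * e 0 := by ring
    refine squeeze_zero (fun n => (he_pos n).le) hle ?_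
    simpa using (tendsto_pow_atTop_nhds_zero_of_lt_one hq0 hq1).mul_const (e 0)
  have hy_inj : Function.Injective y := fun n m hnm => he_anti.injective <| by
    simp only [he, hysucc, hnm]
  have hcauchy : ∀ ε > (0 : ℝ), ∃ K : ℕ, ∀ r s', K ≤ s' → s' < r → d (y r) (y s') < ε := by
    intro ε hε
    have hlim : Tendsto (fun n => 2 * e n + (a₂ + a₃) * (e n * (e n + 1)) + L * e n) atTop
        (𝓝 (2 * 0 + (a₂ + a₃) * (0 * (0 + 1)) + L * 0)) :=
      ((he_lim.const_mul 2).add ((he_lim.mul (he_lim.add_const 1)).const_mul _)).add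
        (he_lim.const_mul L)
    have h1a : 0 < 1 - a₁ := by linarith
    have hev := (hlim.eventually_lt_const (u := (1 - a₁) * ε) (by
      simpa using mul_pos h1a hε)).and (he_lim.eventually_lt_const hε)
    obtain ⟨K, hK1, hK2⟩ := hev.exists
    refine ⟨K, fun r s hs hsr => ?_⟩
    have hes : e s ≤ e K := he_anti.antitone hs
    have her : e r ≤ e K := he_anti.antitone (hs.trans hsr.le)
    rcases eq_or_ne r (s + 1) with rfl | hr
    · rw [hd_symm]; exact hes.trans_lt hK2
    · have hquad := hd_quad (y r) (y s) (y (r + 1)) (y (s + 1))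
        (hy_inj.ne (by omega)) (hy_inj.ne (by omega)) (hy_inj.ne hr)
        (hy_inj.ne (by omega)) (hy_inj.ne (by omega)) (hy_inj.ne (by omega))
      have hc := hweak (h (y r)) (h (y s))
      rw [hA, hA, hB, hB] at hc
      rw [hd_symm (y (s + 1))] at hquad
      change d (y (r + 1)) (y (s + 1)) ≤ _ + a₂ * (e r * (e s + 1)) + a₃ * (e s * (e r + 1))
        + L * e r at hc
      change _ ≤ e r + _ + e s at hquad
      have h0 := he_pos r
      have h0' := he_pos s
      have h0'' := he_pos K
      have b1 : a₂ * (e r * (e s + 1)) ≤ a₂ * (e K * (e K + 1)) := by gcongr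
      have b2 : a₃ * (e s * (e r + 1)) ≤ a₃ * (e K * (e K + 1)) := by gcongr
      have b3 : L * e r ≤ L * e K := by gcongr
      refine lt_of_mul_lt_mul_left ?_ h1a.le
      linarith
  obtain ⟨p, ⟨u, rfl⟩, hp⟩ := hcomplete y hyB hcauchy
  have hev_ne : ∀ z, ∀ᶠ n in atTop, y n ≠ z := by
    intro z
    rw [← Nat.cofinite_eq_atTop]
    exact hy_inj.tendsto_cofinite.eventually (eventually_cofinite_ne z)
  have hev : ∀ᶠ n in atTop, d (B u) (A u) ≤ d (y n) (B u) + e n + (a₁ * d (y n) (B u)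
      + a₂ * (e n * (d (B u) (A u) + 1)) + a₃ * (d (B u) (A u) * (e n + 1)) + L * e n) := by
    filter_upwards [hev_ne (B u), hev_ne (A u), (tendsto_add_atTop_nat 1).eventually (hev_ne (B u)),
      (tendsto_add_atTop_nat 1).eventually (hev_ne (A u))] with n h1 h2 h3 h4
    have hquad := hd_quad (B u) (A u) (y n) (y (n + 1)) (hne u).symm h1.symm h3.symm h2.symm
      h4.symm (hy_inj.ne (by omega))
    have hc := hweak (h (y n)) u
    rw [hA, hB] at hc
    rw [hd_symm (B u) (y n)] at hquad
    linarith
  have hlim := (hp.add he_lim).add ((((hp.const_mul a₁).add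
    ((he_lim.mul_const (d (B u) (A u) + 1)).const_mul a₂)).add
    (((he_lim.add_const 1).const_mul (d (B u) (A u))).const_mul a₃)).add (he_lim.const_mul L))
  have hle := ge_of_tendsto hlim hev
  have hpos : 0 < d (B u) (A u) := lt_of_le_of_ne (hd_nonneg _ _) fun h0 =>
    hne u ((hd_eq _ _).1 h0.symm).symm
  nlinarith

/-- **Corollary 3.1.** The coincidence/common fixed point theorem for the linear rational-type
contraction with coefficients `a₁ + a₂ + a₃ < 1`. -/
theorem coincidence_point_linear_rational_contraction
    {X : Type*} [Nonempty X] (d : X → X → ℝ)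
    (hd_nonneg : ∀ x y, 0 ≤ d x y)
    (hd_eq : ∀ x y, d x y = 0 ↔ x = y)
    (hd_symm : ∀ x y, d x y = d y x)
    (hd_quad : ∀ w x y z : X, w ≠ x → w ≠ y → w ≠ z → x ≠ y → x ≠ z → y ≠ z →
      d w x ≤ d w y + d y z + d z x)
    (A B : X → X)
    (hAB : Set.range A ⊆ Set.range B)
    (hcomplete : ∀ s : ℕ → X, (∀ n, s n ∈ Set.range B) →
      (∀ ε > (0 : ℝ), ∃ K : ℕ, ∀ r s', K ≤ s' → s' < r → d (s r) (s s') < ε) →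
      ∃ x ∈ Set.range B, Filter.Tendsto (fun n => d (s n) x) Filter.atTop (nhds 0))
    (a₁ a₂ a₃ L : ℝ)
    (ha₁ : 0 ≤ a₁) (ha₂ : 0 ≤ a₂) (ha₃ : 0 ≤ a₃) (hL : 0 ≤ L)
    (hsum : a₁ + a₂ + a₃ < 1)
    (hcontr : ∀ x y : X,
      d (A x) (A y) ≤
        a₁ * d (B x) (B y)
        + a₂ * (d (B x) (A x) * (d (B y) (A y) + 1) / (1 + d (B x) (B y)))
        + a₃ * (d (B y) (A y) * (d (B x) (A x) + 1) / (1 + d (B x) (B y)))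
        + L * min (min (d (B x) (A x)) (d (B y) (A y)))
                  (min (d (B x) (A y)) (d (B y) (A x)))) :
    (∃! z : X, ∃ u : X, z = A u ∧ z = B u) ∧
    ((∀ u : X, A u = B u → A (B u) = B (A u)) →
      ∃! z : X, A z = z ∧ B z = z) := by
  have huniq : ∀ u v, A u = B u → A v = B v → B u = B v := by
    intro u v hu hv
    have h := hcontr u v
    have hzero : ∀ x, d x x = 0 := fun x => (hd_eq x x).2 rfl
    have hmin : min (min (0 : ℝ) 0) (min (d (B u) (B v)) (d (B v) (B u))) = 0 := by
      rw [min_self, min_eq_left (le_min (hd_nonneg _ _) (hd_nonneg _ _))]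
    rw [hu, hv, hzero, hzero, hmin] at h
    simp only [zero_mul, zero_div, mul_zero, add_zero] at h
    exact (hd_eq _ _).1 (le_antisymm (by nlinarith [hd_nonneg (B u) (B v)]) (hd_nonneg _ _))
  obtain ⟨u, hu⟩ := exists_coincidence_of_rational_contraction d hd_nonneg hd_eq hd_symm hd_quad
    A B hAB hcomplete a₁ a₂ a₃ L ha₁ ha₂ ha₃ hL hsum hcontr
  refine ⟨⟨B u, ⟨u, hu.symm, rfl⟩, ?_⟩, fun hwc => ⟨B u, ?_, ?_⟩⟩
  · rintro _ ⟨v, rfl, hv⟩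
    exact hv.trans (huniq v u hv hu)
  · have hcomm : A (B u) = B (B u) := by rw [hwc u hu, hu]
    have hfix := huniq (B u) u hcomm hu
    exact ⟨hcomm.trans hfix, hfix⟩
  · rintro z ⟨hzA, hzB⟩
    rw [← huniq z u (hzA.trans hzB.symm) hu, hzB]
end

section
/- Let (X,d) be a complete generalized metric space, A : X → X a self-mapping, and β : X × X → [0,∞). Suppose φ : [0,∞) → [0,∞) is continuous, nondecreasing, with φ(t) = 0 ⟺ t = 0 and φ(t) < t for t > 0, and ψ : [0,∞) → [0,∞) is lower semicontinuous with ψ(t) = 0 ⟺ t = 0, and for all x, y ∈ X: φ(β(x,y)·d(Ax,Ay)) ≤ φ(M(x,y)) − ψ(M(x,y)), where M(x,y) = max{d(x,y), d(x,Ax)(d(y,Ay)+1)/(1+d(x,y)), d(y,Ay)(d(x,Ax)+1)/(1+d(x,y))}. Assume: (i) there exists x₀ ∈ X with β(x₀, Ax₀) ≥ 1; (ii) A is β-admissible (β(x,y) ≥ 1 implies β(Ax,Ay) ≥ 1); (iii) X is β-regular and β(xₘ,xₙ) ≥ 1 for all distinct indices m ≠ n of the Picard iterates xₙ = Aⁿx₀;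 (iv) whenever x = Ax and y = Ay, either β(x,y) ≥ 1 or β(y,x) ≥ 1. Then A has a unique fixed point in X. -/
open Filter Topology

/-- The rational expression bounding `d (A x) (A y)` in the contraction condition. -/
noncomputable def ratMax {X : Type*} (d : X → X → ℝ) (A : X → X) (x y : X) : ℝ :=
  max (d x y)
    (max (d x (A x) * (d y (A y) + 1) / (1 + d x y))
      (d y (A y) * (d x (A x) + 1) / (1 + d x y)))

section ComparisonFunctions

variable {φ ψ : ℝ → ℝ}

/-- Near a positive `L`, the inequality `φ a ≤ φ M - ψ M` fails. -/
lemma exists_gap (hφ_cont : ContinuousOn φ (Set.Ici 0))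
    (hψ_nonneg : ∀ t, 0 ≤ t → 0 ≤ ψ t)
    (hψ_lsc : LowerSemicontinuousOn ψ (Set.Ici 0))
    (hψ_zero : ∀ t, 0 ≤ t → (ψ t = 0 ↔ t = 0)) {L : ℝ} (hL : 0 < L) :
    ∃ δ > 0, ∀ a M, |a - L| < δ → |M - L| < δ → ¬ φ a ≤ φ M - ψ M := by
  have hψL : 0 < ψ L :=
    lt_of_le_of_ne (hψ_nonneg L hL.le) fun h => hL.ne' ((hψ_zero L hL.le).1 h.symm)
  have hn : Set.Ici (0 : ℝ) ∈ 𝓝 L := Ici_mem_nhds hL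
  have h1 : ∀ᶠ t in 𝓝 L, ψ L / 2 < ψ t := by
    have := hψ_lsc L hL.le (ψ L / 2) (by linarith)
    rwa [nhdsWithin_eq_nhds.2 hn] at this
  have h2 : ∀ᶠ t in 𝓝 L, |φ t - φ L| < ψ L / 4 :=
    Metric.tendsto_nhds.1 (hφ_cont.continuousAt hn) _ (by linarith)
  obtain ⟨δ, hδ, h⟩ := Metric.eventually_nhds_iff.1 (h1.and h2)
  refine ⟨δ, hδ, fun a M ha hM hle => ?_⟩
  have ha' := abs_lt.1 (h (y := a) ha).2
  have hM' := h (y := M) hM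
  have hM'' := abs_lt.1 hM'.2
  linarith [hM'.1]

lemma le_of_comparison (hφ_mono : MonotoneOn φ (Set.Ici 0))
    (hφ_zero : ∀ t, 0 ≤ t → (φ t = 0 ↔ t = 0))
    (hψ_nonneg : ∀ t, 0 ≤ t → 0 ≤ ψ t)
    (hψ_zero : ∀ t, 0 ≤ t → (ψ t = 0 ↔ t = 0)) {a M : ℝ} (ha : 0 ≤ a) (hM : 0 ≤ M)
    (h : φ a ≤ φ M - ψ M) : a ≤ M := by
  by_contra! hlt
  have h1 := hφ_mono hM ha hlt.le
  have h2 := hψ_nonneg M hM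
  have h3 : M = 0 := (hψ_zero M hM).1 (by linarith)
  have h4 : φ a = 0 := by linarith [(hφ_zero M hM).2 h3, (hψ_zero M hM).2 h3]
  linarith [(hφ_zero a ha).1 h4]

end ComparisonFunctions

section Relation

variable {R : ℝ → ℝ → Prop}

/-- A nonnegative sequence whose successive terms are related, up to a vanishing antitone error,
by a relation that fails near the positive diagonal tends to zero. -/
lemma tendsto_zero_of_relation (hR_le : ∀ {a M}, 0 ≤ a → 0 ≤ M → R a M → a ≤ M)
    (hR_gap : ∀ {L}, 0 < L → ∃ δ > 0, ∀ a M, |a - L| < δ → |M - L| < δ → ¬ R a M)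
    {e c M : ℕ → ℝ} (he : ∀ n, 0 ≤ e n) (hc : Antitone c) (hc0 : Tendsto c atTop (𝓝 0))
    (heM : ∀ n, e n ≤ M n) (hMc : ∀ n, M n ≤ max (e n) (c n))
    (hR : ∀ n, R (e (n + 1)) (M n)) : Tendsto e atTop (𝓝 0) := by
  have hanti : Antitone fun n => max (e n) (c n) := antitone_nat_of_succ_le fun n =>
    max_le ((hR_le (he _) ((he n).trans (heM n)) (hR n)).trans (hMc n))
      ((hc n.le_succ).trans (le_max_right _ _))
  have hbdd : BddBelow (Set.range fun n => max (e n) (c n)) :=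
    ⟨0, by rintro _ ⟨n, rfl⟩; exact (he n).trans (le_max_left _ _)⟩
  have hlim := tendsto_atTop_ciInf hanti hbdd
  set u := ⨅ n, max (e n) (c n)
  have hu : 0 ≤ u := ge_of_tendsto' hlim fun n => (he n).trans (le_max_left _ _)
  rcases hu.eq_or_lt with hu | hu
  · rw [← hu] at hlim
    exact squeeze_zero he (fun n => le_max_left _ _) hlim
  · exfalso
    have hce : ∀ᶠ n in atTop, max (e n) (c n) = e n := by
      filter_upwards [hc0.eventually_lt_const hu] with n hn
      have : u ≤ max (e n) (c n) := ciInf_le hbdd n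
      refine max_eq_left ?_
      rcases le_max_iff.1 this with h | h <;> linarith
    have helim : Tendsto e atTop (𝓝 u) := hlim.congr' hce
    have hMlim : Tendsto M atTop (𝓝 u) :=
      tendsto_of_tendsto_of_tendsto_of_le_of_le helim hlim heM hMc
    obtain ⟨δ, hδ, hgap⟩ := hR_gap hu
    have h1 := Metric.tendsto_nhds.1 (helim.comp (tendsto_add_atTop_nat 1)) δ hδ
    obtain ⟨n, hn1, hn2⟩ := (h1.and (Metric.tendsto_nhds.1 hMlim δ hδ)).exists
    exact hgap _ _ hn1 hn2 (hR n)

end Relation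

section Metric

variable {X : Type*} {d : X → X → ℝ} {A : X → X}

lemma le_ratMax (x y : X) : d x y ≤ ratMax d A x y := le_max_left _ _

lemma ratMax_le (hd : ∀ x y, 0 ≤ d x y) {x y : X} {t : ℝ} (hx : d x (A x) ≤ t)
    (hy : d y (A y) ≤ t) : ratMax d A x y ≤ max (d x y) (t * (1 + t)) := by
  have hxy := hd x y
  have hx0 := hd x (A x)
  have hy0 := hd y (A y)
  refine max_le_max le_rfl (max_le ?_ ?_)
  · refine (div_le_self (by positivity) (by linarith)).trans ?_
    exact mul_le_mul hx (by linarith) (by linarith) (by linarith)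
  · refine (div_le_self (by positivity) (by linarith)).trans ?_
    exact mul_le_mul hy (by linarith) (by linarith) (by linarith)

lemma ratMax_succ_le (hd : ∀ x y, 0 ≤ d x y) (x : X) :
    ratMax d A x (A x) ≤ max (d x (A x)) (d (A x) (A (A x))) := by
  have h1 := hd x (A x)
  have h2 := hd (A x) (A (A x))
  refine max_le (le_max_left _ _) (max_le ?_ ?_)
  · rw [div_le_iff₀ (by linarith)]
    rcases le_total (d x (A x)) (d (A x) (A (A x))) with h | h
    · rw [max_eq_right h]; nlinarith
    · rw [max_eq_left h]; nlinarith
  · refine le_trans (le_of_eq ?_) (le_max_right _ _)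
    field_simp
    ring

/-- In a generalized metric space, an injective sequence whose one- and two-step distances vanish
is Cauchy as soon as it is contractive for a relation failing near the positive diagonal. -/
lemma cauchy_of_relation {R : ℝ → ℝ → Prop}
    (hR_gap : ∀ {L}, 0 < L → ∃ δ > 0, ∀ a M, |a - L| < δ → |M - L| < δ → ¬ R a M)
    (hd : ∀ x y, 0 ≤ d x y) (hd_symm : ∀ x y, d x y = d y x)
    (hd_quad : ∀ w x y z : X, w ≠ x → w ≠ y → w ≠ z → x ≠ y → x ≠ z → y ≠ z →
      d w x ≤ d w y + d y z + d z x)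
    {s : ℕ → X} (hs : ∀ n, A (s n) = s (n + 1)) (hinj : Function.Injective s)
    (h1 : Tendsto (fun n => d (s n) (s (n + 1))) atTop (𝓝 0))
    (h2 : Tendsto (fun n => d (s n) (s (n + 2))) atTop (𝓝 0))
    (hR : ∀ m n, m ≠ n → R (d (s (m + 1)) (s (n + 1))) (ratMax d A (s m) (s n)))
    {ε : ℝ} (hε : 0 < ε) :
    ∃ K : ℕ, ∀ r t, K ≤ t → t < r → d (s r) (s t) < ε := by
  obtain ⟨δ, hδ, hgap⟩ := hR_gap hε
  obtain ⟨η, hη, hη1, hηε, hηδ⟩ : ∃ η : ℝ, 0 < η ∧ η ≤ 1 ∧ 2 * η ≤ ε ∧ 4 * η ≤ δ :=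
    ⟨min 1 (min (ε / 2) (δ / 4)), by positivity, min_le_left _ _,
      by linarith [(min_le_right 1 (min (ε / 2) (δ / 4))).trans (min_le_left _ _)],
      by linarith [(min_le_right 1 (min (ε / 2) (δ / 4))).trans (min_le_right _ _)]⟩
  obtain ⟨K, hK⟩ := eventually_atTop.1
    ((h1.eventually_lt_const hη).and (h2.eventually_lt_const hη))
  have key : ∀ k t, K ≤ t → d (s (t + k + 1)) (s t) < ε := by
    intro k
    induction k with
    | zero => intro t ht; rw [hd_symm]; linarith [(hK t ht).1]
    | succ k ih =>
      intro t ht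
      rcases Nat.eq_zero_or_pos k with rfl | hk
      · rw [hd_symm]; linarith [(hK t ht).2]
      by_contra! hge
      have hprev := ih t ht
      have hne : ∀ {i j}, i ≠ j → s i ≠ s j := fun h => hinj.ne h
      have q1 := hd_quad (s (t + (k + 1) + 1)) (s t) (s (t + k)) (s (t + k + 1))
        (hne (by omega)) (hne (by omega)) (hne (by omega)) (hne (by omega)) (hne (by omega))
        (hne (by omega))
      have e1 := hK (t + k) (by omega)
      have e2 := hK (t + (k + 1) + 1) (by omega)
      have e3 := hK t ht
      have e1' : d (s (t + (k + 1) + 1)) (s (t + k)) < η := by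
        rw [hd_symm]; exact e1.2
      set m := t + (k + 1) + 1 with hm
      have q2 := hd_quad (s m) (s t) (s (m + 1)) (s (t + 1))
        (hne (by omega)) (hne (by omega)) (hne (by omega)) (hne (by omega)) (hne (by omega))
        (hne (by omega))
      have q3 := hd_quad (s (m + 1)) (s (t + 1)) (s m) (s t)
        (hne (by omega)) (hne (by omega)) (hne (by omega)) (hne (by omega)) (hne (by omega))
        (hne (by omega))
      rw [hd_symm (s (t + 1)) (s t)] at q2
      rw [hd_symm (s (m + 1)) (s m)] at q3
      have hM : ratMax d A (s m) (s t) = d (s m) (s t) := by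
        refine le_antisymm ((ratMax_le hd (t := η) ?_ ?_).trans ?_) (le_ratMax _ _)
        · rw [hs]; exact e2.1.le
        · rw [hs]; exact e3.1.le
        · refine max_le le_rfl ?_
          nlinarith
      refine hgap _ _ ?_ ?_ (hR m t (by omega))
      · rw [abs_lt]; constructor <;> linarith [e1.1, e2.1, e3.1]
      · rw [hM, abs_lt]; constructor <;> linarith [e1.1]
  refine ⟨K, fun r t ht htr => ?_⟩
  obtain ⟨k, rfl⟩ := Nat.exists_eq_add_of_lt htr
  exact key k t ht

/-- The limit of an injective Picard sequence is a fixed point when the contraction relation holds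
between the limit and frequently many terms of the sequence. -/
lemma fixed_of_tendsto {R : ℝ → ℝ → Prop}
    (hR_gap : ∀ {L}, 0 < L → ∃ δ > 0, ∀ a M, |a - L| < δ → |M - L| < δ → ¬ R a M)
    (hd : ∀ x y, 0 ≤ d x y) (hd_eq : ∀ x y, d x y = 0 ↔ x = y)
    (hd_symm : ∀ x y, d x y = d y x)
    (hd_quad : ∀ w x y z : X, w ≠ x → w ≠ y → w ≠ z → x ≠ y → x ≠ z → y ≠ z →
      d w x ≤ d w y + d y z + d z x)
    {s : ℕ → X} (hs : ∀ n, A (s n) = s (n + 1)) (hinj : Function.Injective s)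
    (h1 : Tendsto (fun n => d (s n) (s (n + 1))) atTop (𝓝 0))
    {z : X} (hz : Tendsto (fun n => d (s n) z) atTop (𝓝 0))
    (hR : ∃ᶠ n in atTop, R (d (s (n + 1)) (A z)) (ratMax d A (s n) z)) : A z = z := by
  by_contra hne
  have hD : 0 < d z (A z) :=
    lt_of_le_of_ne (hd _ _) fun h => hne ((hd_eq _ _).1 h.symm).symm
  have hev : ∀ w : X, ∀ᶠ n in atTop, s n ≠ w := fun w => by
    have := hinj.tendsto_cofinite.eventually (Set.finite_singleton w).eventually_cofinite_notMem
    rwa [Nat.cofinite_eq_atTop] at this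
  have hsum : Tendsto (fun n => d (s n) (s (n + 1)) + d (s n) z) atTop (𝓝 0) := by
    simpa using h1.add hz
  have hM : Tendsto (fun n => ratMax d A (s n) z) atTop (𝓝 (d z (A z))) := by
    have hone : Tendsto (fun n => 1 + d (s n) z) atTop (𝓝 1) := by
      simpa using hz.const_add 1
    have hA : Tendsto (fun n => d (s n) (s (n + 1)) * (d z (A z) + 1) / (1 + d (s n) z))
        atTop (𝓝 0) := by
      simpa [Pi.div_def] using (h1.mul_const (d z (A z) + 1)).div hone one_ne_zero
    have hB : Tendsto (fun n => d z (A z) * (d (s n) (s (n + 1)) + 1) / (1 + d (s n) z))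
        atTop (𝓝 (d z (A z))) := by
      simpa [Pi.div_def] using ((h1.add_const 1).const_mul (d z (A z))).div hone one_ne_zero
    have := hz.max (hA.max hB)
    simp only [max_eq_right hD.le] at this
    simpa only [ratMax, hs] using this
  obtain ⟨δ, hδ, hgap⟩ := hR_gap hD
  have hev' := (tendsto_add_atTop_nat 1).eventually ((hev z).and (hev (A z)))
  obtain ⟨n, hn, hnz, hnA, hnz', hnsum, hnM⟩ := (hR.and_eventually
    ((hev z).and ((hev (A z)).and (hev'.and ((hsum.eventually_lt_const hδ).and
      (Metric.tendsto_nhds.1 hM δ hδ)))))).exists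
  have hss : s n ≠ s (n + 1) := hinj.ne (by omega)
  have q1 := hd_quad z (A z) (s n) (s (n + 1)) (Ne.symm hne) hnz.symm hnz'.1.symm hnA.symm
    hnz'.2.symm hss
  have q2 := hd_quad (s (n + 1)) (A z) (s n) z hnz'.2 hss.symm hnz'.1 hnA.symm hne hnz
  rw [hd_symm z (s n)] at q1
  rw [hd_symm (s (n + 1)) (s n)] at q2
  refine hgap _ _ ?_ hnM hn
  rw [abs_lt]
  constructor <;> linarith

end Metric


/-- **Corollary 3.3.** Unique fixed point theorem for a `(β,ψ,φ)`-contraction of rational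
type on a complete generalized metric space. -/
theorem fixed_point_beta_psi_phi_contraction
    {X : Type*} [Nonempty X] (d : X → X → ℝ)
    (hd_nonneg : ∀ x y, 0 ≤ d x y)
    (hd_eq : ∀ x y, d x y = 0 ↔ x = y)
    (hd_symm : ∀ x y, d x y = d y x)
    (hd_quad : ∀ w x y z : X, w ≠ x → w ≠ y → w ≠ z → x ≠ y → x ≠ z → y ≠ z →
      d w x ≤ d w y + d y z + d z x)
    (hcomplete : ∀ s : ℕ → X,
      (∀ ε > (0 : ℝ), ∃ K : ℕ, ∀ r s', K ≤ s' → s' < r → d (s r) (s s') < ε) →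
      ∃ x : X, Filter.Tendsto (fun n => d (s n) x) Filter.atTop (nhds 0))
    (A : X → X)
    (β : X → X → ℝ) (hβ_nonneg : ∀ x y, 0 ≤ β x y)
    (φ : ℝ → ℝ)
    (hφ_nonneg : ∀ t, 0 ≤ t → 0 ≤ φ t)
    (hφ_cont : ContinuousOn φ (Set.Ici 0))
    (hφ_mono : MonotoneOn φ (Set.Ici 0))
    (hφ_zero : ∀ t, 0 ≤ t → (φ t = 0 ↔ t = 0))
    (hφ_lt : ∀ t, 0 < t → φ t < t)
    (ψ : ℝ → ℝ)
    (hψ_nonneg : ∀ t, 0 ≤ t → 0 ≤ ψ t)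
    (hψ_lsc : LowerSemicontinuousOn ψ (Set.Ici 0))
    (hψ_zero : ∀ t, 0 ≤ t → (ψ t = 0 ↔ t = 0))
    (hcontr : ∀ x y : X,
      φ (β x y * d (A x) (A y)) ≤
        φ (max (d x y)
            (max (d x (A x) * (d y (A y) + 1) / (1 + d x y))
                 (d y (A y) * (d x (A x) + 1) / (1 + d x y))))
        - ψ (max (d x y)
            (max (d x (A x) * (d y (A y) + 1) / (1 + d x y))
                 (d y (A y) * (d x (A x) + 1) / (1 + d x y)))))
    (x₀ : X)
    (hx₀ : 1 ≤ β x₀ (A x₀))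
    (hadm : ∀ x y : X, 1 ≤ β x y → 1 ≤ β (A x) (A y))
    (hreg : ∀ (s : ℕ → X) (l : X), (∀ n, 1 ≤ β (s n) (s (n + 1))) →
      Filter.Tendsto (fun n => d (s n) l) Filter.atTop (nhds 0) →
      ∃ σ : ℕ → ℕ, StrictMono σ ∧ ∀ k, 1 ≤ β (s (σ k)) l)
    (hiter : ∀ m n : ℕ, m ≠ n → 1 ≤ β (A^[m] x₀) (A^[n] x₀))
    (hfix : ∀ x y : X, A x = x → A y = y → 1 ≤ β x y ∨ 1 ≤ β y x) :
    ∃! z : X, A z = z := by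
  have hgap : ∀ {L : ℝ}, 0 < L →
      ∃ δ > 0, ∀ a M, |a - L| < δ → |M - L| < δ → ¬ φ a ≤ φ M - ψ M :=
    fun hL => exists_gap hφ_cont hψ_nonneg hψ_lsc hψ_zero hL
  have hle : ∀ {a M : ℝ}, 0 ≤ a → 0 ≤ M → φ a ≤ φ M - ψ M → a ≤ M :=
    fun ha hM h => le_of_comparison hφ_mono hφ_zero hψ_nonneg hψ_zero ha hM h
  have hirr : ∀ {L : ℝ}, 0 ≤ L → φ L ≤ φ L - ψ L → L = 0 := fun {L} hL h =>
    (hψ_zero L hL).1 (by linarith [hψ_nonneg L hL])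
  have hR : ∀ x y, 1 ≤ β x y →
      φ (d (A x) (A y)) ≤ φ (ratMax d A x y) - ψ (ratMax d A x y) := fun x y h =>
    (hφ_mono (hd_nonneg _ _) (mul_nonneg (hβ_nonneg _ _) (hd_nonneg _ _))
      (le_mul_of_one_le_left (hd_nonneg _ _) h)).trans (hcontr x y)
  have huniq : ∀ x y, A x = x → A y = y → 1 ≤ β x y → x = y := by
    intro x y hx hy h
    have h1 := hR x y h
    have hM : ratMax d A x y = d x y := by
      simp [ratMax, hx, hy, (hd_eq x x).2 rfl, (hd_eq y y).2 rfl, hd_nonneg]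
    rw [hM, hx, hy] at h1
    exact (hd_eq x y).1 (hirr (hd_nonneg _ _) h1)
  suffices hex : ∃ z, A z = z by
    obtain ⟨z, hz⟩ := hex
    refine ⟨z, hz, fun y hy => ?_⟩
    rcases hfix y z hy hz with h | h
    · exact huniq y z hy hz h
    · exact (huniq z y hz hy h).symm
  by_contra! hno
  set s : ℕ → X := fun n => A^[n] x₀ with hs_def
  have hs : ∀ n, A (s n) = s (n + 1) := fun n => (Function.iterate_succ_apply' A n x₀).symm
  have hRs : ∀ m n, m ≠ n → φ (d (s (m + 1)) (s (n + 1))) ≤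
      φ (ratMax d A (s m) (s n)) - ψ (ratMax d A (s m) (s n)) := fun m n hmn => by
    simpa only [hs] using hR (s m) (s n) (hiter m n hmn)
  have hpos : ∀ n, 0 < d (s n) (s (n + 1)) := fun n =>
    lt_of_le_of_ne (hd_nonneg _ _) fun h =>
      hno (s n) ((hs n).trans ((hd_eq _ _).1 h.symm).symm)
  have hMnn : ∀ x y, 0 ≤ ratMax d A x y := fun x y => (hd_nonneg x y).trans (le_ratMax x y)
  have hlt : ∀ n, d (s (n + 1)) (s (n + 2)) < d (s n) (s (n + 1)) := by
    intro n
    by_contra! h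
    have h1 := hRs n (n + 1) (by omega)
    have h2 : ratMax d A (s n) (s (n + 1)) = d (s (n + 1)) (s (n + 2)) := by
      refine le_antisymm ?_ (hle (hd_nonneg _ _) (hMnn _ _) h1)
      have := ratMax_succ_le (A := A) hd_nonneg (s n)
      rw [hs, hs] at this
      exact this.trans (max_le h le_rfl)
    rw [h2] at h1
    exact (hpos (n + 1)).ne' (hirr (hd_nonneg _ _) h1)
  have hanti : StrictAnti fun n => d (s n) (s (n + 1)) := strictAnti_nat_of_succ_lt hlt
  have hinj : Function.Injective s := fun m n hmn => hanti.injective <| by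
    simp only [← hs, hmn]
  have h1 : Tendsto (fun n => d (s n) (s (n + 1))) atTop (𝓝 0) := by
    refine tendsto_zero_of_relation (R := fun a M => φ a ≤ φ M - ψ M) hle hgap
      (c := fun _ => 0) (M := fun n => ratMax d A (s n) (s (n + 1)))
      (fun n => hd_nonneg _ _) antitone_const tendsto_const_nhds (fun n => le_ratMax _ _)
      (fun n => ?_) (fun n => hRs n (n + 1) (by omega))
    have := ratMax_succ_le (A := A) hd_nonneg (s n)
    rw [hs, hs, max_eq_left (hlt n).le] at this
    exact this.trans (le_max_left _ _)
  have h2 : Tendsto (fun n => d (s n) (s (n + 2))) atTop (𝓝 0) := by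
    refine tendsto_zero_of_relation (R := fun a M => φ a ≤ φ M - ψ M) hle hgap
      (c := fun n => d (s n) (s (n + 1)) * (1 + d (s n) (s (n + 1))))
      (M := fun n => ratMax d A (s n) (s (n + 2)))
      (fun n => hd_nonneg _ _) (fun m n hmn => ?_) ?_ (fun n => le_ratMax _ _)
      (fun n => ?_) (fun n => hRs n (n + 2) (by omega))
    · have := hanti.antitone hmn
      have h3 := hpos n
      have h4 := hpos m
      dsimp only at this ⊢
      gcongr
    · simpa using h1.mul (h1.const_add 1)
    · refine ratMax_le hd_nonneg (by rw [hs]) ?_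
      rw [hs]
      exact hanti.antitone (by omega : n ≤ n + 2)
  obtain ⟨z, hz⟩ := hcomplete s fun ε hε =>
    cauchy_of_relation (A := A) (R := fun a M => φ a ≤ φ M - ψ M) hgap hd_nonneg hd_symm hd_quad
      hs hinj h1 h2 hRs hε
  obtain ⟨σ, hσ, hσβ⟩ := hreg s z (fun n => hiter n (n + 1) (by omega)) hz
  refine hno z (fixed_of_tendsto (R := fun a M => φ a ≤ φ M - ψ M) hgap hd_nonneg hd_eq hd_symm
    hd_quad hs hinj h1 hz ?_)
  refine hσ.tendsto_atTop.frequently (Frequently.of_forall fun k => ?_)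
  simpa only [hs] using hR (s (σ k)) z (hσβ k)
end

section
/- Let (X,d) be a generalized metric space, A, B : X → X with A(X) ⊆ B(X), and β : X × X → [0,∞). Suppose φ : [0,∞) → [0,∞) is continuous, nondecreasing, with φ(t) = 0 ⟺ t = 0 and φ(t) < t for t > 0, ψ : [0,∞) → [0,∞) is lower semicontinuous with ψ(t) = 0 ⟺ t = 0, and φ(β(Bx,By)·d(Ax,Ay)) ≤ φ(M(x,y)) − ψ(M(x,y)) for all x, y ∈ X, where M(x,y) = max{d(Bx,By), d(Bx,Ax)(d(By,Ay)+1)/(1+d(Bx,By)), d(By,Ay)(d(Bx,Ax)+1)/(1+d(Bx,By))}. Assume A is B-β-admissible and there exists x₀ with β(Bx₀, Ax₀) ≥ 1. Let (xₙ) be a sequence starting from x₀ with B x_{n+1} = A xₙ for all n, set zₙ = A xₙ, and assume zₙ ≠ z_{n+1} for all n. Then the sequence (d(zₙ, z_{n+1})) is strictly decreasing and converges to 0. -/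
/-- The rational control term of the contraction, evaluated along consecutive points of the
Picard–Jungck sequence, is the larger of the two consecutive distances. -/
theorem max_rational_eq_max {a b : ℝ} (ha : 0 ≤ a) :
    max a (max (a * (b + 1) / (1 + a)) (b * (a + 1) / (1 + a))) = max a b := by
  have ha' : 0 < 1 + a := by linarith
  have hb : b * (a + 1) / (1 + a) = b := by field_simp; ring
  rw [hb]
  rcases le_total a b with h | h
  · have : a * (b + 1) / (1 + a) ≤ b := by
      rw [div_le_iff₀ ha']; nlinarith
    rw [max_eq_right this]
  · have : a * (b + 1) / (1 + a) ≤ a := by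
      rw [div_le_iff₀ ha']; nlinarith
    rw [max_left_comm, max_eq_right (this.trans (le_max_left a b))]

/-- An antitone nonnegative sequence with `φ (a (n + 1)) ≤ φ (a n) - ψ (a n)` tends to `0` when
`φ` is continuous and `ψ` is lower semicontinuous and positive on `(0, ∞)`. -/
theorem tendsto_zero_of_antitone_of_le_sub {a : ℕ → ℝ} {φ ψ : ℝ → ℝ}
    (ha : ∀ n, 0 ≤ a n) (hanti : Antitone a)
    (hφ : ContinuousOn φ (Set.Ici 0)) (hψ : LowerSemicontinuousOn ψ (Set.Ici 0))
    (hψ_pos : ∀ t, 0 < t → 0 < ψ t) (h : ∀ n, φ (a (n + 1)) ≤ φ (a n) - ψ (a n)) :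
    Filter.Tendsto a Filter.atTop (nhds 0) := by
  have hbdd : BddBelow (Set.range a) := ⟨0, by rintro _ ⟨n, rfl⟩; exact ha n⟩
  have hlim := tendsto_atTop_ciInf hanti hbdd
  set r := ⨅ n, a n
  have hr : 0 ≤ r := ge_of_tendsto' hlim ha
  rcases hr.eq_or_lt with hr0 | hr0
  · rwa [← hr0] at hlim
  exfalso
  have hwithin : Filter.Tendsto a Filter.atTop (nhdsWithin r (Set.Ici 0)) :=
    tendsto_nhdsWithin_iff.2 ⟨hlim, Filter.Eventually.of_forall ha⟩
  have hφa : Filter.Tendsto (fun n => φ (a n)) Filter.atTop (nhds (φ r)) :=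
    (hφ r hr).tendsto.comp hwithin
  have hdiff := hφa.sub (hφa.comp (Filter.tendsto_add_atTop_nat 1))
  rw [sub_self] at hdiff
  have hpos := hψ_pos r hr0
  have hψa := hwithin.eventually (hψ r hr (ψ r / 2) (half_lt_self hpos))
  obtain ⟨n, hn, hn'⟩ := (hψa.and (hdiff.eventually_lt_const (half_pos hpos))).exists
  have := h n
  simp only [Function.comp_apply] at hn'
  linarith

/-- For the Picard–Jungck sequence `zₙ = A xₙ = B x_{n+1}` of a `(β,ψ,φ)`-contraction pair of
rational type on a generalized metric space, the consecutive distances `d(zₙ, z_{n+1})`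
form a strictly decreasing sequence converging to `0`. -/
theorem beta_psi_phi_consecutive_distances_strictAnti_tendsto_zero
    {X : Type*} [Nonempty X] (d : X → X → ℝ)
    (hd_nonneg : ∀ x y, 0 ≤ d x y)
    (hd_eq : ∀ x y, d x y = 0 ↔ x = y)
    (hd_symm : ∀ x y, d x y = d y x)
    (hd_quad : ∀ w x y z : X, w ≠ x → w ≠ y → w ≠ z → x ≠ y → x ≠ z → y ≠ z →
      d w x ≤ d w y + d y z + d z x)
    (A B : X → X)
    (hAB : Set.range A ⊆ Set.range B)
    (β : X → X → ℝ) (hβ_nonneg : ∀ x y, 0 ≤ β x y)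
    (φ : ℝ → ℝ)
    (hφ_nonneg : ∀ t, 0 ≤ t → 0 ≤ φ t)
    (hφ_cont : ContinuousOn φ (Set.Ici 0))
    (hφ_mono : MonotoneOn φ (Set.Ici 0))
    (hφ_zero : ∀ t, 0 ≤ t → (φ t = 0 ↔ t = 0))
    (hφ_lt : ∀ t, 0 < t → φ t < t)
    (ψ : ℝ → ℝ)
    (hψ_nonneg : ∀ t, 0 ≤ t → 0 ≤ ψ t)
    (hψ_lsc : LowerSemicontinuousOn ψ (Set.Ici 0))
    (hψ_zero : ∀ t, 0 ≤ t → (ψ t = 0 ↔ t = 0))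
    (hcontr : ∀ x y : X,
      φ (β (B x) (B y) * d (A x) (A y)) ≤
        φ (max (d (B x) (B y))
            (max (d (B x) (A x) * (d (B y) (A y) + 1) / (1 + d (B x) (B y)))
                 (d (B y) (A y) * (d (B x) (A x) + 1) / (1 + d (B x) (B y)))))
        - ψ (max (d (B x) (B y))
            (max (d (B x) (A x) * (d (B y) (A y) + 1) / (1 + d (B x) (B y)))
                 (d (B y) (A y) * (d (B x) (A x) + 1) / (1 + d (B x) (B y))))))
    (hadm : ∀ x y : X, 1 ≤ β (B x) (B y) → 1 ≤ β (A x) (A y))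
    (x₀ : X) (hx₀ : 1 ≤ β (B x₀) (A x₀))
    (x : ℕ → X) (hx0 : x 0 = x₀) (hx : ∀ n, B (x (n + 1)) = A (x n))
    (z : ℕ → X) (hz : ∀ n, z n = A (x n))
    (hne : ∀ n, z n ≠ z (n + 1)) :
    StrictAnti (fun n => d (z n) (z (n + 1))) ∧
    Filter.Tendsto (fun n => d (z n) (z (n + 1))) Filter.atTop (nhds 0) := by
  have hψ_pos : ∀ t, 0 < t → 0 < ψ t := fun t ht =>
    (hψ_nonneg t ht.le).lt_of_ne fun h => ht.ne' ((hψ_zero t ht.le).1 h.symm)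
  have hpos : ∀ n, 0 < d (z n) (z (n + 1)) := fun n =>
    (hd_nonneg _ _).lt_of_ne fun h => hne n ((hd_eq _ _).1 h.symm)
  have hβ : ∀ n, 1 ≤ β (z n) (z (n + 1)) := by
    intro n
    rw [hz, hz]
    induction n with
    | zero => exact hadm _ _ (by rw [hx, hx0]; exact hx₀)
    | succ n ih => exact hadm _ _ (by rw [hx, hx]; exact ih)
  have key : ∀ n, φ (d (z (n + 1)) (z (n + 2))) ≤
      φ (max (d (z n) (z (n + 1))) (d (z (n + 1)) (z (n + 2)))) -
        ψ (max (d (z n) (z (n + 1))) (d (z (n + 1)) (z (n + 2)))) := by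
    intro n
    have h := hcontr (x (n + 1)) (x (n + 2))
    rw [hx, hx, ← hz, ← hz, ← hz, max_rational_eq_max (hd_nonneg _ _)] at h
    have hle := le_mul_of_one_le_left (hd_nonneg (z (n + 1)) (z (n + 2))) (hβ n)
    exact (hφ_mono (hd_nonneg _ _) ((hd_nonneg _ _).trans hle) hle).trans h
  have hlt : ∀ n, d (z (n + 1)) (z (n + 2)) < d (z n) (z (n + 1)) := by
    intro n
    by_contra! hle
    have h := key n
    rw [max_eq_right hle] at h
    linarith [hψ_pos _ (hpos (n + 1))]
  have hanti : StrictAnti fun n => d (z n) (z (n + 1)) := strictAnti_nat_of_succ_lt hlt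
  refine ⟨hanti, tendsto_zero_of_antitone_of_le_sub (fun n => (hpos n).le) hanti.antitone
    hφ_cont hψ_lsc hψ_pos fun n => ?_⟩
  have h := key n
  rwa [max_eq_left (hlt n).le] at h
end

section
/- Let S and E be nonempty sets, G : S × E → S, h : S × E → ℝ bounded, and F : S × E × ℝ → ℝ with (a,b) ↦ F(a,b,0) and (a,b) ↦ F(a,b,1) bounded and |F(a,b,t₁) − F(a,b,t₂)| ≤ C₀|t₁ − t₂| for some C₀ ≥ 0 and all a, b, t₁, t₂. Define Z : B(S) → B(S) by (Zw)(a) = sup_{b∈E} { h(a,b) + F(a,b, w(G(a,b))) } and O : B(S) → B(S) by Ow = Z(Zw). Suppose there exist C ≥ 0 and a function φ : [0,∞) → [0,∞), continuous, nondecreasing, with φ(t) = 0 ⟺ t = 0 and φ(t) < t for t > 0, such that for all w₁, w₂ ∈ B(S): sup_{a∈S, b∈E} |F(a,b, (Zw₁)(G(a,b))) − F(a,b, (Zw₂)(G(a,b)))| ≤ φ(M(w₁,w₂)) + C·m(w₁,w₂), where M(w₁,w₂) = max{ d∞(Zw₁,Zw₂), d∞(Zw₁,Ow₁)(d∞(Zw₂,Ow₂)+1)/(1+d∞(Zw₁,Zw₂)),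 d∞(Zw₂,Ow₂)(d∞(Zw₁,Ow₁)+1)/(1+d∞(Zw₁,Zw₂)) } and m(w₁,w₂) = min{ d∞(Zw₁,Ow₁), d∞(Zw₂,Ow₂), d∞(Zw₁,Ow₂), d∞(Zw₂,Ow₁) }. Then the system of functional equations w(a) = sup_{b∈E}{h(a,b) + F(a,b, z(G(a,b)))}, z(a) = sup_{b∈E}{h(a,b) + F(a,b, w(G(a,b)))} has a unique common solution w₀ ∈ B(S), i.e., there is a unique w₀ ∈ B(S) with w₀(a) = sup_{b∈E}{ h(a,b) + F(a,b, w₀(G(a,b))) } for all a ∈ S. -/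
/-- A real-valued function is bounded. -/
def IsBddFun {S : Type*} (w : S → ℝ) : Prop := ∃ M : ℝ, ∀ a, |w a| ≤ M

/-- The Bellman-type operator `(Zw)(a) = sup_{b∈E} { h(a,b) + F(a,b, w(G(a,b))) }`. -/
noncomputable def bellmanOp {S E : Type*} (G : S → E → S) (h : S → E → ℝ)
    (F : S → E → ℝ → ℝ) (w : S → ℝ) : S → ℝ :=
  fun a => ⨆ b, (h a b + F a b (w (G a b)))

/-- The sup-distance `d∞(T₁,T₂) = sup_{x∈S} |T₁(x) − T₂(x)|` on functions. -/
noncomputable def dSup {S : Type*} (T₁ T₂ : S → ℝ) : ℝ := ⨆ x, |T₁ x - T₂ x|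

open Filter Topology

/-- A continuous self-map of a complete metric space satisfying a rational-type contraction
condition on its range has a unique fixed point. -/
theorem existsUnique_isFixedPt_of_rational_contraction {X : Type*} [MetricSpace X]
    [CompleteSpace X] [Nonempty X] {T : X → X} (hT : Continuous T) {C : ℝ} (hC : 0 ≤ C)
    {φ : ℝ → ℝ} (hφ_cont : ContinuousOn φ (Set.Ici 0)) (hφ_mono : MonotoneOn φ (Set.Ici 0))
    (hφ_lt : ∀ t, 0 < t → φ t < t) (hφ_zero : φ 0 = 0)
    (hcontr : ∀ x y, dist (T (T x)) (T (T y)) ≤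
      φ (max (dist (T x) (T y))
          (max (dist (T x) (T (T x)) * (dist (T y) (T (T y)) + 1) / (1 + dist (T x) (T y)))
            (dist (T y) (T (T y)) * (dist (T x) (T (T x)) + 1) / (1 + dist (T x) (T y))))) +
      C * min (min (dist (T x) (T (T x))) (dist (T y) (T (T y))))
        (min (dist (T x) (T (T y))) (dist (T y) (T (T x))))) :
    ∃! x, T x = x := by
  obtain ⟨x₀⟩ := ‹Nonempty X›
  let x : ℕ → X := fun n => T^[n + 1] x₀
  have hx : ∀ n, T (x n) = x (n + 1) := fun n => (Function.iterate_succ_apply' T (n + 1) x₀).symm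
  have hrange : ∀ n, ∃ y, T y = x n := fun n =>
    ⟨T^[n] x₀, (Function.iterate_succ_apply' T n x₀).symm⟩
  have hφ_le : ∀ t, 0 ≤ t → φ t ≤ t := fun t ht => by
    rcases ht.eq_or_lt with rfl | ht
    · exact hφ_zero.le
    · exact (hφ_lt t ht).le
  let D : ℕ → ℝ := fun n => dist (x n) (x (n + 1))
  have hD : ∀ n, 0 ≤ D n := fun n => dist_nonneg
  have hcontr_seq : ∀ n m, dist (x (n + 1)) (x (m + 1)) ≤
      φ (max (dist (x n) (x m))
          (max (D n * (D m + 1) / (1 + dist (x n) (x m)))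
            (D m * (D n + 1) / (1 + dist (x n) (x m))))) +
      C * min (min (D n) (D m)) (min (dist (x n) (x (m + 1))) (dist (x m) (x (n + 1)))) := by
    intro n m
    obtain ⟨y, hy⟩ := hrange n
    obtain ⟨z, hz⟩ := hrange m
    have := hcontr y z
    rwa [hy, hz, hx, hx] at this
  have hstep : ∀ n, D (n + 1) ≤ φ (D n) := by
    intro n
    have h0 := hD n
    have h1 := hD (n + 1)
    have hle : D (n + 1) ≤ φ (max (D n) (max (D n * (D (n + 1) + 1) / (1 + D n))
        (D (n + 1) * (D n + 1) / (1 + D n)))) := by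
      have := hcontr_seq n (n + 1)
      rw [dist_self (x (n + 1)), min_eq_right (dist_nonneg (x := x n) (y := x (n + 1 + 1))),
        min_eq_right (le_min h0 h1), mul_zero, add_zero] at this
      exact this
    have hpos : 0 < 1 + D n := by linarith
    have hbound : ∀ t, D n ≤ t → D (n + 1) ≤ t →
        D (n + 1) ≤ φ t := by
      intro t ht0 ht1
      refine hle.trans (hφ_mono (h0.trans (le_max_left _ _)) (h0.trans ht0) ?_)
      refine max_le ht0 (max_le ?_ ?_)
      · rw [div_le_iff₀ hpos]
        nlinarith [mul_le_mul_of_nonneg_left ht1 h0]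
      · rw [div_le_iff₀ hpos]
        nlinarith [mul_le_mul_of_nonneg_left ht1 h0]
    refine hbound _ le_rfl ?_
    by_contra! hlt
    exact absurd (hbound _ hlt.le le_rfl) (not_le.2 (hφ_lt _ (h0.trans_lt hlt)))
  have hanti : Antitone D := antitone_nat_of_succ_le fun n => (hstep n).trans (hφ_le _ (hD n))
  have hD_lim : Tendsto D atTop (𝓝 0) := by
    have hlim := tendsto_atTop_ciInf hanti ⟨0, by rintro _ ⟨n, rfl⟩; exact hD n⟩
    set L := ⨅ n, D n
    have hL : 0 ≤ L := ge_of_tendsto' hlim hD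
    have hφlim : Tendsto (fun n => φ (D n)) atTop (𝓝 (φ L)) :=
      (hφ_cont L hL).tendsto.comp
        (tendsto_nhdsWithin_iff.2 ⟨hlim, Eventually.of_forall fun n => hD n⟩)
    have hLφ : L ≤ φ L := le_of_tendsto_of_tendsto' ((tendsto_add_atTop_iff_nat 1).2 hlim) hφlim hstep
    rcases hL.eq_or_lt with h | h
    · rwa [← h] at hlim
    · exact absurd hLφ (not_le.2 (hφ_lt L h))
  have hcauchy : CauchySeq x := by
    refine Metric.cauchySeq_iff'.2 fun ε' hε' => ?_
    obtain ⟨ε, hε, hεε'⟩ := exists_between hε'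
    have hgap : 0 < ε - φ ε := sub_pos.2 (hφ_lt ε hε)
    have hδ : 0 < min 1 (min (ε / 2) ((ε - φ ε) / (1 + C))) := by positivity
    obtain ⟨N, hN⟩ := (hD_lim.eventually (gt_mem_nhds hδ)).exists
    obtain ⟨hN1, hN2, hN3⟩ : D N < 1 ∧ D N < ε / 2 ∧ D N < (ε - φ ε) / (1 + C) := by
      simpa only [lt_min_iff] using hN
    rw [lt_div_iff₀ (by positivity)] at hN3
    have hball : ∀ k, dist (x N) (x (N + k)) ≤ ε := by
      intro k
      induction k with
      | zero => simpa using hε.le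
      | succ k ih =>
        have hk : D (N + k) ≤ D N := hanti (Nat.le_add_right N k)
        have hr : 0 ≤ dist (x N) (x (N + k)) := dist_nonneg
        have h0 := hD N
        have h1 := hD (N + k)
        have hφM : φ (max (dist (x N) (x (N + k)))
            (max (D N * (D (N + k) + 1) / (1 + dist (x N) (x (N + k))))
              (D (N + k) * (D N + 1) / (1 + dist (x N) (x (N + k)))))) ≤ φ ε := by
          refine hφ_mono (hr.trans (le_max_left _ _)) hε.le (max_le ih (max_le ?_ ?_)) <;>
          · refine (div_le_self (by positivity) (by linarith)).trans ?_
            nlinarith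
        have hmin : C * min (min (D N) (D (N + k)))
            (min (dist (x N) (x (N + k + 1))) (dist (x (N + k)) (x (N + 1)))) ≤ C * D N :=
          mul_le_mul_of_nonneg_left ((min_le_left _ _).trans (min_le_left _ _)) hC
        have htri : dist (x N) (x (N + k + 1)) ≤ D N + dist (x (N + 1)) (x (N + k + 1)) :=
          dist_triangle _ _ _
        have := hcontr_seq N (N + k)
        rw [← add_assoc]
        linarith
    refine ⟨N, fun n hn => ?_⟩
    obtain ⟨k, rfl⟩ := Nat.exists_eq_add_of_le hn
    rw [dist_comm]
    exact (hball k).trans_lt hεε'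
  obtain ⟨p, hp⟩ := cauchySeq_tendsto_of_complete hcauchy
  have hTp : T p = p := by
    refine tendsto_nhds_unique ((hT.tendsto p).comp hp) ?_
    simpa only [Function.comp_def, hx] using (tendsto_add_atTop_iff_nat 1).2 hp
  refine ⟨p, hTp, fun q hq => ?_⟩
  by_contra hne
  have hlt := hφ_lt _ (dist_pos.2 hne)
  have hle := hcontr q p
  simp only [show T q = q from hq, hTp, dist_self, zero_mul, zero_div, max_self, min_self,
    max_eq_left (dist_nonneg (x := q) (y := p)),
    min_eq_left (le_min (dist_nonneg (x := q) (y := p)) (dist_nonneg (x := p) (y := q))),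
    mul_zero, add_zero] at hle
  exact absurd hle (not_le.2 hlt)

theorem abs_iSup_sub_iSup_le {ι : Type*} [Nonempty ι] {f g : ι → ℝ} {K : ℝ}
    (hf : BddAbove (Set.range f)) (hg : BddAbove (Set.range g)) (h : ∀ i, |f i - g i| ≤ K) :
    |(⨆ i, f i) - ⨆ i, g i| ≤ K := by
  rw [abs_sub_le_iff, sub_le_iff_le_add, sub_le_iff_le_add]
  constructor <;> refine ciSup_le fun i => ?_
  · linarith [le_ciSup hg i, (abs_le.1 (h i)).2]
  · linarith [le_ciSup hf i, (abs_le.1 (h i)).1]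

section Bellman

variable {S E : Type*} {G : S → E → S} {h : S → E → ℝ} {F : S → E → ℝ → ℝ} {C₀ : ℝ}

theorem exists_abs_bellman_integrand_le (hh : ∃ M : ℝ, ∀ a b, |h a b| ≤ M)
    (hF0 : ∃ M : ℝ, ∀ a b, |F a b 0| ≤ M) (hC₀ : 0 ≤ C₀)
    (hFlip : ∀ a b t₁ t₂, |F a b t₁ - F a b t₂| ≤ C₀ * |t₁ - t₂|)
    {w : S → ℝ} (hw : IsBddFun w) : ∃ M : ℝ, ∀ a b, |h a b + F a b (w (G a b))| ≤ M := by
  obtain ⟨A, hA⟩ := hh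
  obtain ⟨B, hB⟩ := hF0
  obtain ⟨W, hW⟩ := hw
  refine ⟨A + (C₀ * W + B), fun a b => (abs_add_le _ _).trans (add_le_add (hA a b) ?_)⟩
  have hlip := hFlip a b (w (G a b)) 0
  rw [sub_zero] at hlip
  linarith [abs_sub_abs_le_abs_sub (F a b (w (G a b))) (F a b 0), hB a b,
    mul_le_mul_of_nonneg_left (hW (G a b)) hC₀]

variable [Nonempty E]

theorem isBddFun_bellmanOp {w : S → ℝ}
    (hw : ∃ M : ℝ, ∀ a b, |h a b + F a b (w (G a b))| ≤ M) : IsBddFun (bellmanOp G h F w) := by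
  obtain ⟨M, hM⟩ := hw
  refine ⟨M, fun a => ?_⟩
  have hbdd : BddAbove (Set.range fun b => h a b + F a b (w (G a b))) :=
    ⟨M, by rintro _ ⟨b, rfl⟩; exact (abs_le.1 (hM a b)).2⟩
  simpa [bellmanOp] using abs_iSup_sub_iSup_le (g := fun _ : E => (0 : ℝ)) hbdd (by simp)
    (fun b => by simpa using hM a b)

theorem abs_bellmanOp_sub_le {w₁ w₂ : S → ℝ} {K : ℝ}
    (hw₁ : ∃ M : ℝ, ∀ a b, |h a b + F a b (w₁ (G a b))| ≤ M)
    (hw₂ : ∃ M : ℝ, ∀ a b, |h a b + F a b (w₂ (G a b))| ≤ M)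
    (hK : ∀ a b, |F a b (w₁ (G a b)) - F a b (w₂ (G a b))| ≤ K) (a : S) :
    |bellmanOp G h F w₁ a - bellmanOp G h F w₂ a| ≤ K := by
  obtain ⟨M₁, hM₁⟩ := hw₁
  obtain ⟨M₂, hM₂⟩ := hw₂
  refine abs_iSup_sub_iSup_le ⟨M₁, ?_⟩ ⟨M₂, ?_⟩ fun b => ?_
  · rintro _ ⟨b, rfl⟩
    exact (abs_le.1 (hM₁ a b)).2
  · rintro _ ⟨b, rfl⟩
    exact (abs_le.1 (hM₂ a b)).2
  · rw [add_sub_add_left_eq_sub]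
    exact hK a b

end Bellman

/-- **Theorem 4.1.** Under the rational-type contraction condition, the system of functional
equations `w(a) = sup_{b}{h(a,b) + F(a,b, z(G(a,b)))}`,
`z(a) = sup_{b}{h(a,b) + F(a,b, w(G(a,b)))}` arising in dynamic programming has a unique
common bounded solution `w₀ ∈ B(S)`. -/
theorem functional_equations_unique_common_solution
    {S E : Type*} [Nonempty S] [Nonempty E]
    (G : S → E → S) (h : S → E → ℝ) (F : S → E → ℝ → ℝ)
    (hh : ∃ M : ℝ, ∀ a b, |h a b| ≤ M)
    (hF0 : ∃ M : ℝ, ∀ a b, |F a b 0| ≤ M)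
    (hF1 : ∃ M : ℝ, ∀ a b, |F a b 1| ≤ M)
    (C₀ : ℝ) (hC₀ : 0 ≤ C₀)
    (hFlip : ∀ a b t₁ t₂, |F a b t₁ - F a b t₂| ≤ C₀ * |t₁ - t₂|)
    (C : ℝ) (hC : 0 ≤ C)
    (φ : ℝ → ℝ)
    (hφ_nonneg : ∀ t, 0 ≤ t → 0 ≤ φ t)
    (hφ_cont : ContinuousOn φ (Set.Ici 0))
    (hφ_mono : MonotoneOn φ (Set.Ici 0))
    (hφ_zero : ∀ t, 0 ≤ t → (φ t = 0 ↔ t = 0))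
    (hφ_lt : ∀ t, 0 < t → φ t < t)
    (hcontr : ∀ w₁ w₂ : S → ℝ, IsBddFun w₁ → IsBddFun w₂ →
      (⨆ p : S × E,
        |F p.1 p.2 ((bellmanOp G h F w₁) (G p.1 p.2)) -
          F p.1 p.2 ((bellmanOp G h F w₂) (G p.1 p.2))|) ≤
      φ (max (dSup (bellmanOp G h F w₁) (bellmanOp G h F w₂))
          (max (dSup (bellmanOp G h F w₁) (bellmanOp G h F (bellmanOp G h F w₁)) *
                  (dSup (bellmanOp G h F w₂) (bellmanOp G h F (bellmanOp G h F w₂)) + 1) /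
                (1 + dSup (bellmanOp G h F w₁) (bellmanOp G h F w₂)))
               (dSup (bellmanOp G h F w₂) (bellmanOp G h F (bellmanOp G h F w₂)) *
                  (dSup (bellmanOp G h F w₁) (bellmanOp G h F (bellmanOp G h F w₁)) + 1) /
                (1 + dSup (bellmanOp G h F w₁) (bellmanOp G h F w₂)))))
      + C * min
          (min (dSup (bellmanOp G h F w₁) (bellmanOp G h F (bellmanOp G h F w₁)))
               (dSup (bellmanOp G h F w₂) (bellmanOp G h F (bellmanOp G h F w₂))))
          (min (dSup (bellmanOp G h F w₁) (bellmanOp G h F (bellmanOp G h F w₂)))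
               (dSup (bellmanOp G h F w₂) (bellmanOp G h F (bellmanOp G h F w₁))))) :
    ∃! w₀ : S → ℝ, IsBddFun w₀ ∧
      ∀ a, w₀ a = ⨆ b, (h a b + F a b (w₀ (G a b))) := by
  let _ : TopologicalSpace S := ⊥
  have : DiscreteTopology S := ⟨rfl⟩
  have hbdd : ∀ f : BoundedContinuousFunction S ℝ, IsBddFun f := fun f =>
    ⟨‖f‖, fun a => f.norm_coe_le_norm a⟩
  have hint : ∀ w : S → ℝ, IsBddFun w → ∃ M : ℝ, ∀ a b, |h a b + F a b (w (G a b))| ≤ M :=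
    fun w hw => exists_abs_bellman_integrand_le hh hF0 hC₀ hFlip hw
  choose toBCF htoBCF using fun (w : S → ℝ) (hw : IsBddFun w) =>
    show ∃ f : BoundedContinuousFunction S ℝ, ⇑f = w from
      ⟨BoundedContinuousFunction.ofNormedAddCommGroupDiscrete w hw.choose hw.choose_spec, rfl⟩
  let T : BoundedContinuousFunction S ℝ → BoundedContinuousFunction S ℝ := fun f =>
    toBCF (bellmanOp G h F f) (isBddFun_bellmanOp (hint f (hbdd f)))
  have hT : ∀ f, ⇑(T f) = bellmanOp G h F f := fun f => htoBCF _ _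
  have hdist : ∀ f g : BoundedContinuousFunction S ℝ, dSup f g = dist f g := fun f g => by
    simp only [dSup, BoundedContinuousFunction.dist_eq_iSup, Real.dist_eq]
  have hF_dist : ∀ (f g : BoundedContinuousFunction S ℝ) a b,
      |F a b (f (G a b)) - F a b (g (G a b))| ≤ C₀ * dist f g := fun f g a b =>
    (hFlip a b _ _).trans (mul_le_mul_of_nonneg_left (f.dist_coe_le_dist (G a b)) hC₀)
  have hT_dist : ∀ (f g : BoundedContinuousFunction S ℝ) (K : ℝ),
      (∀ a b, |F a b (f (G a b)) - F a b (g (G a b))| ≤ K) → dist (T f) (T g) ≤ K := by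
    intro f g K hK
    refine BoundedContinuousFunction.dist_le_iff_of_nonempty.2 fun a => ?_
    rw [hT, hT, Real.dist_eq]
    exact abs_bellmanOp_sub_le (hint f (hbdd f)) (hint g (hbdd g)) hK a
  have hT_cont : Continuous T :=
    (LipschitzWith.of_dist_le_mul (K := C₀.toNNReal) fun f g => by
      rw [Real.coe_toNNReal _ hC₀]
      exact hT_dist f g _ (hF_dist f g)).continuous
  obtain ⟨p, hp, hp_unique⟩ := existsUnique_isFixedPt_of_rational_contraction hT_cont hC hφ_cont
    hφ_mono hφ_lt ((hφ_zero 0 le_rfl).2 rfl) fun f g => by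
      have hfg := hcontr f g (hbdd f) (hbdd g)
      simp only [← hT, hdist] at hfg
      refine le_trans (hT_dist _ _ _ fun a b => ?_) hfg
      refine le_ciSup (f := fun q : S × E => |F q.1 q.2 (T f (G q.1 q.2)) -
        F q.1 q.2 (T g (G q.1 q.2))|) ⟨C₀ * dist (T f) (T g), ?_⟩ (a, b)
      rintro _ ⟨q, rfl⟩
      exact hF_dist _ _ _ _
  refine ⟨p, ⟨hbdd p, fun a => ?_⟩, fun w hw => ?_⟩
  · exact (congrFun (congrArg DFunLike.coe hp) a).symm.trans (congrFun (hT p) a)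
  · rw [← htoBCF w hw.1, ← hp_unique (toBCF w hw.1)]
    refine DFunLike.coe_injective ?_
    rw [hT, htoBCF]
    exact (funext hw.2).symm
end
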